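/- Let K be a convex body in ℝ^n. If the Euclidean unit ball B^n ⊆ K is the John ellipsoid of K, then ℓ(K) ≥ ℓ(Δ_n°), and if B^n ⊇ K is the Löwner ellipsoid of K, then W(K) ≥ W(Δ_n). In either case equality holds if and only if K is a regular simplex (circumscribed about B^n, respectively inscribed in B^n). -/

import Mathlib

open MeasureTheory Metric Set
open scoped RealInnerProductSpace ENNReal

noncomputable section

/-- The standard Gaussian measure `γ_n` on `ℝ^n`. -/
def gaussianM (n : ℕ) : Measure (EuclideanSpace ℝ (Fin n)) :=
  volume.withDensity fun x =>
    ENNReal.ofReal ((2 * Real.pi) ^ (-(n : ℝ) / 2) * Real.exp (-‖x‖ ^ 2 / 2))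

/-- The ℓ-norm of a convex body: `ℓ(K) = ∫ ‖x‖_K dγ_n(x)`, where `‖·‖_K` is the gauge of `K`. -/
def ellNorm (n : ℕ) (K : Set (EuclideanSpace ℝ (Fin n))) : ℝ :=
  ∫ x, gauge K x ∂(gaussianM n)

/-- The support function `h_K`. -/
def suppFn {n : ℕ} (K : Set (EuclideanSpace ℝ (Fin n))) (u : EuclideanSpace ℝ (Fin n)) : ℝ :=
  sSup ((fun y => ⟪u, y⟫) '' K)

/-- The mean width `W(K) = (1/(n κ_n)) ∫_{S^{n-1}} (h_K(u) + h_K(-u)) du`, the integration over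
the unit sphere being with respect to the (n-1)-dimensional Hausdorff measure. -/
def meanWidth (n : ℕ) (K : Set (EuclideanSpace ℝ (Fin n))) : ℝ :=
  (1 / (n * (volume (closedBall (0 : EuclideanSpace ℝ (Fin n)) 1)).toReal)) *
    ∫ u in sphere (0 : EuclideanSpace ℝ (Fin n)) 1,
      (suppFn K u + suppFn K (-u)) ∂(μH[(n : ℝ) - 1])

/-- The polar set `K° = {x : ⟨x,y⟩ ≤ 1 for all y ∈ K}`. -/
def polarSet {n : ℕ} (K : Set (EuclideanSpace ℝ (Fin n))) : Set (EuclideanSpace ℝ (Fin n)) :=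
  {x | ∀ y ∈ K, ⟪x, y⟫ ≤ 1}

/-- `w` lists the vertices of a regular simplex inscribed in the unit ball: `n+1` unit vectors
with pairwise inner products `-1/n`. -/
def IsRegVerts {n : ℕ} (w : Fin (n + 1) → EuclideanSpace ℝ (Fin n)) : Prop :=
  (∀ i, ‖w i‖ = 1) ∧ ∀ i j, i ≠ j → ⟪w i, w j⟫ = -1 / n

/-- An ellipsoid: an image of the closed Euclidean unit ball under an invertible affine map. -/
def IsEllipsoid {n : ℕ} (D : Set (EuclideanSpace ℝ (Fin n))) : Prop :=
  ∃ f : EuclideanSpace ℝ (Fin n) ≃ᵃ[ℝ] EuclideanSpace ℝ (Fin n),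
    D = f '' closedBall 0 1

/-- `D` is the Löwner ellipsoid (minimal volume ellipsoid containing) of `K`. -/
def IsLoewnerEllipsoid {n : ℕ} (D K : Set (EuclideanSpace ℝ (Fin n))) : Prop :=
  IsEllipsoid D ∧ K ⊆ D ∧ ∀ D', IsEllipsoid D' → K ⊆ D' → volume D ≤ volume D'

/-- `D` is the John ellipsoid (maximal volume ellipsoid contained in) of `K`. -/
def IsJohnEllipsoid {n : ℕ} (D K : Set (EuclideanSpace ℝ (Fin n))) : Prop :=
  IsEllipsoid D ∧ D ⊆ K ∧ ∀ D', IsEllipsoid D' → D' ⊆ K → volume D' ≤ volume D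

/-! ### Gaussian measure -/

lemma gaussDens_pos (n : ℕ) (x : EuclideanSpace ℝ (Fin n)) :
    0 < (2 * Real.pi) ^ (-(n : ℝ) / 2) * Real.exp (-‖x‖ ^ 2 / 2) := by
  have := Real.pi_pos
  positivity

lemma gaussDens_integrable (n : ℕ) :
    Integrable (fun x : EuclideanSpace ℝ (Fin n) =>
      (2 * Real.pi) ^ (-(n : ℝ) / 2) * Real.exp (-‖x‖ ^ 2 / 2)) := by
  have h := (GaussianFourier.integrable_cexp_neg_mul_sq_norm_add (b := 1/2) (by norm_num) 0
    (0 : EuclideanSpace ℝ (Fin n))).norm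
  refine Integrable.const_mul (h.congr (Filter.Eventually.of_forall fun x => ?_)) _
  simp only [Complex.norm_exp]
  congr 1
  simp [← Complex.ofReal_pow]
  ring

lemma gaussianM_finite (n : ℕ) : IsFiniteMeasure (gaussianM n) := by
  refine isFiniteMeasure_withDensity_ofReal (gaussDens_integrable n).2

lemma gaussianM_eq (n : ℕ) :
    gaussianM n = ProbabilityTheory.stdGaussian (EuclideanSpace ℝ (Fin n)) := by
  haveI := gaussianM_finite n
  apply Measure.ext_of_charFun
  ext t
  rw [ProbabilityTheory.charFun_stdGaussian, charFun_apply, gaussianM,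
    integral_withDensity_eq_integral_toReal_smul (by fun_prop)
      (Filter.Eventually.of_forall fun x => ENNReal.ofReal_lt_top)]
  have h := GaussianFourier.integral_cexp_neg_mul_sq_norm_add (b := 1/2) (by norm_num) Complex.I t
  have h2 : ∀ x : EuclideanSpace ℝ (Fin n), (ENNReal.ofReal
      ((2 * Real.pi) ^ (-(n : ℝ) / 2) * Real.exp (-‖x‖ ^ 2 / 2))).toReal •
        Complex.exp (⟪x, t⟫ * Complex.I)
      = (((2 * Real.pi) ^ (-(n : ℝ) / 2) : ℝ) : ℂ) *
        Complex.exp (-(1/2) * ‖x‖ ^ 2 + Complex.I * ⟪t, x⟫) := by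
    intro x
    rw [ENNReal.toReal_ofReal (gaussDens_pos n x).le, Complex.real_smul, Complex.ofReal_mul,
      Complex.ofReal_exp, mul_assoc, ← Complex.exp_add, real_inner_comm]
    congr 2
    push_cast
    ring
  simp_rw [h2]
  rw [integral_const_mul, h, ← mul_assoc]
  have h3 : (((2 * Real.pi) ^ (-(n : ℝ) / 2) : ℝ) : ℂ) *
      ((Real.pi : ℂ) / (1/2)) ^ ((Module.finrank ℝ (EuclideanSpace ℝ (Fin n)) : ℂ) / 2) = 1 := by
    have : ((Real.pi : ℂ) / (1/2)) = ((2 * Real.pi : ℝ) : ℂ) := by push_cast; ring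
    rw [this]
    have h4 : ((Module.finrank ℝ (EuclideanSpace ℝ (Fin n)) : ℂ) / 2) = (((n:ℝ) / 2 : ℝ) : ℂ) := by
      simp
    rw [h4, ← Complex.ofReal_cpow (by positivity), ← Complex.ofReal_mul,
      ← Real.rpow_add (by positivity)]
    have : -(n:ℝ)/2 + n/2 = 0 := by ring
    rw [this]; simp
  rw [h3, one_mul]
  congr 1
  simp
  ring

lemma gaussianM_prob (n : ℕ) : IsProbabilityMeasure (gaussianM n) := by
  rw [gaussianM_eq]; infer_instance

lemma gaussianM_openPos (n : ℕ) : (gaussianM n).IsOpenPosMeasure := by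
  have : (volume : Measure (EuclideanSpace ℝ (Fin n))) ≪ gaussianM n := by
    refine withDensity_absolutelyContinuous' (by fun_prop) (Filter.Eventually.of_forall fun x => ?_)
    simpa using gaussDens_pos n x
  exact this.isOpenPosMeasure

lemma gaussianM_norm_integrable (n : ℕ) :
    Integrable (fun x : EuclideanSpace ℝ (Fin n) => ‖x‖) (gaussianM n) := by
  rw [gaussianM_eq]
  exact ProbabilityTheory.IsGaussian.integrable_id.norm

lemma gaussianM_map (n : ℕ) (f : EuclideanSpace ℝ (Fin n) ≃ₗᵢ[ℝ] EuclideanSpace ℝ (Fin n)) :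
    (gaussianM n).map f = gaussianM n := by
  simp only [gaussianM_eq]
  exact ProbabilityTheory.stdGaussian_map f

lemma gaussianM_inner_integral (n : ℕ) (v : EuclideanSpace ℝ (Fin n)) :
    ∫ x, ⟪x, v⟫ ∂(gaussianM n) = 0 := by
  rw [gaussianM_eq]
  have := ProbabilityTheory.integral_strongDual_stdGaussian (innerSL ℝ v)
  simpa [real_inner_comm] using this

/-- one-dimensional Gaussian distribution function -/
def Phi (t : ℝ) : ℝ := (ProbabilityTheory.gaussianReal 0 1).real (Iio t)

lemma gaussianM_orthant (N : ℕ) (b : OrthonormalBasis (Fin N) ℝ (EuclideanSpace ℝ (Fin N)))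
    (t : ℝ) : (gaussianM N).real {y | ∀ j, ⟪y, b j⟫ < t} = Phi t ^ N := by
  have hm : Measurable (fun x : Fin N → ℝ => ∑ i, x i • b i) := by fun_prop
  have hs : MeasurableSet {y : EuclideanSpace ℝ (Fin N) | ∀ j, ⟪y, b j⟫ < t} := by
    rw [Set.setOf_forall]
    exact MeasurableSet.iInter fun j => measurableSet_lt (by fun_prop) (by fun_prop)
  rw [gaussianM_eq, ProbabilityTheory.stdGaussian_eq_map_pi_orthonormalBasis b, Measure.real,
    Measure.map_apply hm hs]
  have : (fun x : Fin N → ℝ => ∑ i, x i • b i) ⁻¹' {y | ∀ j, ⟪y, b j⟫ < t}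
      = Set.pi univ fun _ => Iio t := by
    ext x
    have h : ∀ j, ⟪∑ i, x i • b i, b j⟫ = x j := by
      intro j
      rw [sum_inner]
      simp [real_inner_smul_left, b.inner_eq_ite]
    simp [h]
  rw [this, Measure.pi_pi]
  simp [Phi, Measure.real]

/-! ### lifting to one more dimension -/

def liftV {n : ℕ} (u : EuclideanSpace ℝ (Fin n)) (s : ℝ) : EuclideanSpace ℝ (Fin (n + 1)) :=
  WithLp.toLp 2 (Fin.cons s (fun i => u i))

def tailV {n : ℕ} (y : EuclideanSpace ℝ (Fin (n + 1))) : EuclideanSpace ℝ (Fin n) :=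
  WithLp.toLp 2 (fun i => y i.succ)

lemma inner_liftV {n : ℕ} (y : EuclideanSpace ℝ (Fin (n + 1))) (u : EuclideanSpace ℝ (Fin n))
    (s : ℝ) : ⟪y, liftV u s⟫ = y 0 * s + ⟪tailV y, u⟫ := by
  simp [PiLp.inner_apply, Fin.sum_univ_succ, liftV, tailV, mul_comm]

lemma tailV_liftV {n : ℕ} (u : EuclideanSpace ℝ (Fin n)) (s : ℝ) : tailV (liftV u s) = u := by
  ext i; simp [tailV, liftV]

lemma liftV_zero {n : ℕ} (u : EuclideanSpace ℝ (Fin n)) (s : ℝ) : liftV u s 0 = s := by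
  simp [liftV]

lemma inner_liftV_liftV {n : ℕ} (u v : EuclideanSpace ℝ (Fin n))
    (s t : ℝ) : ⟪liftV u s, liftV v t⟫ = s * t + ⟪u, v⟫ := by
  rw [inner_liftV, tailV_liftV, liftV_zero]

lemma continuous_tailV {n : ℕ} : Continuous (tailV (n := n)) := by
  unfold tailV; fun_prop

lemma gaussianM_tail (n : ℕ) : (gaussianM (n + 1)).map tailV = gaussianM n := by
  haveI := gaussianM_prob (n+1)
  haveI := gaussianM_prob n
  haveI : IsProbabilityMeasure ((gaussianM (n + 1)).map tailV) :=
    Measure.isProbabilityMeasure_map continuous_tailV.aemeasurable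
  apply Measure.ext_of_charFun
  ext t
  rw [charFun_apply, integral_map continuous_tailV.aemeasurable
    (Measurable.aestronglyMeasurable (by fun_prop))]
  have h : ∀ y : EuclideanSpace ℝ (Fin (n+1)), ⟪tailV y, t⟫ = ⟪y, liftV t 0⟫ := by
    intro y; rw [inner_liftV]; simp
  simp_rw [h]
  rw [← charFun_apply, gaussianM_eq, gaussianM_eq, ProbabilityTheory.charFun_stdGaussian,
    ProbabilityTheory.charFun_stdGaussian]
  have : ‖liftV t 0‖ = ‖t‖ := by
    rw [norm_eq_sqrt_real_inner, norm_eq_sqrt_real_inner, inner_liftV_liftV]; simp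
  rw [this]

/-! ### The one-dimensional transport map -/

open ProbabilityTheory in
lemma Phi_eq (t : ℝ) : Phi t = ∫ x in Iic t, gaussianPDFReal 0 1 x := by
  rw [Phi, Measure.real, gaussianReal_apply_eq_integral 0 one_ne_zero,
    ENNReal.toReal_ofReal (integral_nonneg fun x => gaussianPDFReal_nonneg 0 1 x),
    integral_Iic_eq_integral_Iio]

open ProbabilityTheory in
lemma Phi_eq_cdf (t : ℝ) : Phi t = cdf (gaussianReal 0 1) t := by
  have := nullSingletonClass_gaussianReal (μ := 0) (one_ne_zero (α := NNReal))
  rw [cdf_eq_real, Phi, Measure.real, Measure.real, measure_congr Iio_ae_eq_Iic]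

def phi (t : ℝ) : ℝ := ProbabilityTheory.gaussianPDFReal 0 1 t

lemma phi_eq (t : ℝ) : phi t = (√(2 * Real.pi))⁻¹ * Real.exp (-t ^ 2 / 2) := by
  simp [phi, ProbabilityTheory.gaussianPDFReal]

lemma phi_pos (t : ℝ) : 0 < phi t := ProbabilityTheory.gaussianPDFReal_pos 0 1 t one_ne_zero

lemma phi_cont : Continuous phi := by
  have : phi = fun t => (√(2 * Real.pi))⁻¹ * Real.exp (-t ^ 2 / 2) := funext phi_eq
  rw [this]; fun_prop

lemma Phi_hasDerivAt (t : ℝ) : HasDerivAt Phi (phi t) t := by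
  have hi : Integrable phi := ProbabilityTheory.integrable_gaussianPDFReal 0 1
  have h : Phi = fun t => Phi 0 + ∫ x in (0:ℝ)..t, phi x := by
    ext t
    rw [← intervalIntegral.integral_Iic_sub_Iic hi.integrableOn hi.integrableOn, Phi_eq, Phi_eq]
    simp [phi]
  rw [h]
  refine HasDerivAt.const_add _ ?_
  exact intervalIntegral.integral_hasDerivAt_right hi.intervalIntegrable
    (phi_cont.stronglyMeasurableAtFilter _ _) phi_cont.continuousAt

lemma Phi_cont : Continuous Phi :=
  continuous_iff_continuousAt.2 fun t => (Phi_hasDerivAt t).continuousAt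

lemma Phi_strictMono : StrictMono Phi :=
  strictMono_of_deriv_pos fun t => by rw [(Phi_hasDerivAt t).deriv]; exact phi_pos t

lemma Phi_atBot : Filter.Tendsto Phi Filter.atBot (nhds 0) := by
  rw [show Phi = _ from funext Phi_eq_cdf]; exact ProbabilityTheory.tendsto_cdf_atBot _

lemma Phi_atTop : Filter.Tendsto Phi Filter.atTop (nhds 1) := by
  rw [show Phi = _ from funext Phi_eq_cdf]; exact ProbabilityTheory.tendsto_cdf_atTop _

lemma Phi_pos (t : ℝ) : 0 < Phi t := by
  have h0 : 0 ≤ Phi (t - 1) := ENNReal.toReal_nonneg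
  exact lt_of_le_of_lt h0 (Phi_strictMono (by linarith))

lemma Phi_lt_one (t : ℝ) : Phi t < 1 := by
  have h0 : Phi (t + 1) ≤ 1 := Phi_strictMono.monotone.ge_of_tendsto Phi_atTop _
  exact lt_of_lt_of_le (Phi_strictMono (by linarith)) h0

lemma Phi_surj {p : ℝ} (h0 : 0 < p) (h1 : p < 1) : ∃ x, Phi x = p := by
  obtain ⟨a, ha⟩ := (Phi_atBot.eventually (gt_mem_nhds h0)).exists
  obtain ⟨b, hb⟩ := (Phi_atTop.eventually (lt_mem_nhds h1)).exists
  exact mem_range_of_exists_le_of_exists_ge Phi_cont ⟨a, ha.le⟩ ⟨b, hb.le⟩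

def Psi (p : ℝ) : ℝ := Function.invFun Phi p

lemma Phi_Psi {p : ℝ} (h0 : 0 < p) (h1 : p < 1) : Phi (Psi p) = p :=
  Function.invFun_eq (Phi_surj h0 h1)

lemma Psi_Phi (x : ℝ) : Psi (Phi x) = x :=
  Function.leftInverse_invFun Phi_strictMono.injective x

lemma Psi_strictMonoOn : StrictMonoOn Psi (Ioo 0 1) := by
  intro p hp q hq hpq
  rw [← Phi_strictMono.lt_iff_lt, Phi_Psi hp.1 hp.2, Phi_Psi hq.1 hq.2]; exact hpq

lemma Psi_continuousAt {p : ℝ} (h0 : 0 < p) (h1 : p < 1) : ContinuousAt Psi p := by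
  refine Psi_strictMonoOn.continuousAt_of_image_mem_nhds (Ioo_mem_nhds h0 h1) ?_
  have : Psi '' Ioo 0 1 = univ := by
    refine eq_univ_of_forall fun x => ⟨Phi x, ⟨Phi_pos x, Phi_lt_one x⟩, Psi_Phi x⟩
  rw [this]; exact Filter.univ_mem

lemma Psi_hasDerivAt {p : ℝ} (h0 : 0 < p) (h1 : p < 1) :
    HasDerivAt Psi (phi (Psi p))⁻¹ p := by
  refine HasDerivAt.of_local_left_inverse (Psi_continuousAt h0 h1) (Phi_hasDerivAt _)
    (phi_pos _).ne' ?_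
  filter_upwards [Ioo_mem_nhds h0 h1] with q hq
  exact Phi_Psi hq.1 hq.2

/-- the monotone transport of the Gaussian conditioned to `(-∞, t)` to the Gaussian -/
def Tr (t s : ℝ) : ℝ := Psi (Phi s / Phi t)

def dTr (t s : ℝ) : ℝ := Real.exp ((Tr t s ^ 2 - s ^ 2) / 2) / Phi t

lemma quot_mem {t s : ℝ} (h : s < t) : 0 < Phi s / Phi t ∧ Phi s / Phi t < 1 :=
  ⟨div_pos (Phi_pos _) (Phi_pos _), (div_lt_one (Phi_pos t)).2 (Phi_strictMono h)⟩

lemma dTr_pos (t s : ℝ) : 0 < dTr t s := div_pos (Real.exp_pos _) (Phi_pos t)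

lemma Tr_hasDerivAt {t s : ℝ} (h : s < t) : HasDerivAt (Tr t) (dTr t s) s := by
  have h1 := (Psi_hasDerivAt (quot_mem h).1 (quot_mem h).2).comp s
    ((Phi_hasDerivAt s).div_const (Phi t))
  refine h1.congr_deriv ?_
  change (phi (Tr t s))⁻¹ * _ = _
  have h2 : √(2 * Real.pi) ≠ 0 := by positivity
  have h3 := (Phi_pos t).ne'
  rw [phi_eq, phi_eq, dTr, show (Tr t s ^ 2 - s ^ 2) / 2 = (-s^2/2) - (-(Tr t s)^2/2) by ring,
    Real.exp_sub]
  have := (Real.exp_pos (-(Tr t s)^2/2)).ne'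
  field_simp

lemma Tr_continuousAt {t s : ℝ} (h : s < t) : ContinuousAt (Tr t) s :=
  (Tr_hasDerivAt h).continuousAt

lemma dTr_continuousAt {t s : ℝ} (h : s < t) : ContinuousAt (dTr t) s := by
  have := Tr_continuousAt h
  unfold dTr
  fun_prop

lemma Tr_strictMonoOn (t : ℝ) : StrictMonoOn (Tr t) (Iio t) := by
  intro a ha b hb hab
  exact Psi_strictMonoOn (quot_mem ha) (quot_mem hb)
    (div_lt_div_of_pos_right (Phi_strictMono hab) (Phi_pos t))

lemma dTr_tendsto (t : ℝ) : Filter.Tendsto (dTr t) (nhdsWithin t (Iio t)) Filter.atTop := by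
  have hT : Filter.Tendsto (Tr t) (nhdsWithin t (Iio t)) Filter.atTop := by
    rw [Filter.tendsto_atTop]
    intro R
    have h1 : Filter.Tendsto (fun s => Phi s / Phi t) (nhdsWithin t (Iio t)) (nhds 1) := by
      have : ContinuousAt (fun s => Phi s / Phi t) t :=
        (Phi_cont.div_const _).continuousAt
      have h2 := this.tendsto
      rw [div_self (Phi_pos t).ne'] at h2
      exact h2.mono_left nhdsWithin_le_nhds
    filter_upwards [h1.eventually (lt_mem_nhds (Phi_lt_one R)), self_mem_nhdsWithin] with s hs hst
    rw [← Phi_strictMono.le_iff_le, Tr, Phi_Psi (quot_mem hst).1 (quot_mem hst).2]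
    exact hs.le
  unfold dTr
  refine Filter.Tendsto.atTop_div_const (Phi_pos t) (Real.tendsto_exp_atTop.comp ?_)
  refine Filter.Tendsto.atTop_div_const (by norm_num) ?_
  have h2 : Filter.Tendsto (fun s : ℝ => -s ^ 2) (nhdsWithin t (Iio t)) (nhds (-t^2)) :=
    ((by fun_prop : Continuous fun s : ℝ => -s ^ 2).tendsto t).mono_left nhdsWithin_le_nhds
  have h3 := ((Filter.tendsto_pow_atTop (two_ne_zero)).comp hT).atTop_add h2
  simpa [Function.comp_def, sub_eq_add_neg] using h3

lemma dTr_not_scale {t a : ℝ} (ht : 0 < t) (ha : a < 1)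
    (h : ∀ s, 0 < s → s < t → dTr t s = dTr t (s * a)) : False := by
  have hc : Filter.Tendsto (fun s => dTr t (s * a)) (nhdsWithin t (Iio t)) (nhds (dTr t (t * a))) := by
    have h1 : ContinuousAt (dTr t) (t * a) := dTr_continuousAt (by nlinarith)
    have h2 : ContinuousAt (fun s => dTr t (s * a)) t :=
      ContinuousAt.comp (f := fun s => s * a) (g := dTr t) h1 (by fun_prop)
    exact h2.tendsto.mono_left nhdsWithin_le_nhds
  have h3 : Filter.Tendsto (dTr t) (nhdsWithin t (Iio t)) (nhds (dTr t (t * a))) := by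
    refine hc.congr' ?_
    filter_upwards [Ioo_mem_nhdsLT ht] with s hs
    exact (h s hs.1 hs.2).symm
  exact not_tendsto_nhds_of_tendsto_atTop (dTr_tendsto t) _ h3

/-! ### The geometric Brascamp-Lieb inequality for half lines -/

section BL
variable {N : ℕ} {ι : Type*} [Fintype ι]

/-- `∑ d_i t_i v_i ⊗ v_i` -/
def Qop (v : ι → EuclideanSpace ℝ (Fin N)) (d t : ι → ℝ) :
    EuclideanSpace ℝ (Fin N) →L[ℝ] EuclideanSpace ℝ (Fin N) :=
  ∑ i, (d i * t i) • (innerSL ℝ (v i)).smulRight (v i)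

lemma Qop_apply (v : ι → EuclideanSpace ℝ (Fin N)) (d t : ι → ℝ) (x : EuclideanSpace ℝ (Fin N)) :
    Qop v d t x = ∑ i, (d i * t i * ⟪v i, x⟫) • v i := by
  simp [Qop, smul_smul]

/-- decomposition of the identity -/
def IsDecomp (v : ι → EuclideanSpace ℝ (Fin N)) (d : ι → ℝ) : Prop :=
  (∀ i, ‖v i‖ = 1) ∧ (∀ i, 0 < d i) ∧ ∀ x, ∑ i, (d i * ⟪v i, x⟫) • v i = x

lemma IsDecomp.sum_sq {v : ι → EuclideanSpace ℝ (Fin N)} {d : ι → ℝ} (h : IsDecomp v d)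
    (x : EuclideanSpace ℝ (Fin N)) : ∑ i, d i * ⟪v i, x⟫ ^ 2 = ‖x‖ ^ 2 := by
  rw [← real_inner_self_eq_norm_sq]
  conv_rhs => rw [← h.2.2 x]
  rw [sum_inner]
  refine Finset.sum_congr rfl fun i _ => ?_
  rw [h.2.2 x, real_inner_smul_left]; ring

lemma IsDecomp.sum_d {v : ι → EuclideanSpace ℝ (Fin N)} {d : ι → ℝ} (h : IsDecomp v d) :
    ∑ i, d i = N := by
  have e := EuclideanSpace.basisFun (Fin N) ℝ
  have h1 : ∑ j, ∑ i, d i * ⟪v i, e j⟫ ^ 2 = N := by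
    simp_rw [h.sum_sq]
    simp
  rw [Finset.sum_comm] at h1
  rw [← h1]
  refine Finset.sum_congr rfl fun i _ => ?_
  rw [← Finset.mul_sum, e.sum_sq_inner_left, h.1 i]; simp

lemma IsDecomp.norm_sq_le {v : ι → EuclideanSpace ℝ (Fin N)} {d : ι → ℝ} (h : IsDecomp v d)
    (T : ι → ℝ) : ‖∑ i, (d i * T i) • v i‖ ^ 2 ≤ ∑ i, d i * T i ^ 2 := by
  set θ := ∑ i, (d i * T i) • v i with hθ
  have h1 : 0 ≤ ∑ i, d i * (T i - ⟪v i, θ⟫) ^ 2 :=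
    Finset.sum_nonneg fun i _ => mul_nonneg (h.2.1 i).le (sq_nonneg _)
  have h2 : ∑ i, d i * T i * ⟪v i, θ⟫ = ‖θ‖ ^ 2 := by
    rw [← real_inner_self_eq_norm_sq]
    conv_rhs => rw [hθ]
    rw [sum_inner]
    refine Finset.sum_congr rfl fun i _ => ?_
    rw [real_inner_smul_left]
  have h3 := h.sum_sq θ
  have h4 : ∑ i, d i * (T i - ⟪v i, θ⟫) ^ 2 = ∑ i, d i * T i ^ 2
      - 2 * ∑ i, d i * T i * ⟪v i, θ⟫ + ∑ i, d i * ⟪v i, θ⟫ ^ 2 := by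
    rw [Finset.mul_sum, ← Finset.sum_sub_distrib, ← Finset.sum_add_distrib]
    exact Finset.sum_congr rfl fun i _ => by ring
  linarith

lemma Qop_symm (v : ι → EuclideanSpace ℝ (Fin N)) (d t : ι → ℝ) :
    (Qop v d t : EuclideanSpace ℝ (Fin N) →ₗ[ℝ] EuclideanSpace ℝ (Fin N)).IsSymmetric := by
  intro x y
  simp only [ContinuousLinearMap.coe_coe, Qop_apply, sum_inner, inner_sum, real_inner_smul_left,
    real_inner_smul_right]
  refine Finset.sum_congr rfl fun i _ => ?_
  rw [real_inner_comm x (v i)]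
  ring

lemma IsDecomp.det_ge {v : ι → EuclideanSpace ℝ (Fin N)} {d : ι → ℝ} (h : IsDecomp v d)
    (t : ι → ℝ) (ht : ∀ i, 0 < t i) :
    Real.exp (∑ i, d i * Real.log (t i)) ≤ (Qop v d t).det ∧
    ((Qop v d t).det = Real.exp (∑ i, d i * Real.log (t i)) →
      ∀ i k, t i ≠ t k → ⟪v i, v k⟫ = 0) := by
  have hs := Qop_symm v d t
  have hfr : Module.finrank ℝ (EuclideanSpace ℝ (Fin N)) = N := by simp
  set e := hs.eigenvectorBasis hfr with he
  set l := hs.eigenvalues hfr with hl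
  have hdet : (Qop v d t).det = ∏ j, l j := by
    have := hs.det_eq_prod_eigenvalues hfr
    simpa using this
  -- weights
  have hw1 : ∀ j, ∑ i, d i * ⟪v i, e j⟫ ^ 2 = 1 := fun j => by
    rw [h.sum_sq, e.norm_eq_one]; simp
  have hw0 : ∀ i j, 0 ≤ d i * ⟪v i, e j⟫ ^ 2 := fun i j => mul_nonneg (h.2.1 i).le (sq_nonneg _)
  have hlj : ∀ j, l j = ∑ i, (d i * ⟪v i, e j⟫ ^ 2) • t i := by
    intro j
    have h1 := hs.apply_eigenvectorBasis hfr j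
    have h2 : ⟪(Qop v d t) (e j), e j⟫ = l j := by
      have : (Qop v d t) (e j) = l j • e j := h1
      rw [this, real_inner_smul_left, real_inner_self_eq_norm_sq, e.norm_eq_one]; simp
    rw [← h2, Qop_apply, sum_inner]
    refine Finset.sum_congr rfl fun i _ => ?_
    rw [real_inner_smul_left, smul_eq_mul]; ring
  have hlog : ∀ j, ∑ i, (d i * ⟪v i, e j⟫ ^ 2) • Real.log (t i) ≤ Real.log (l j) := by
    intro j
    rw [hlj]
    exact strictConcaveOn_log_Ioi.concaveOn.le_map_sum (fun i _ => hw0 i j) (hw1 j)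
      (fun i _ => ht i)
  have hlpos : ∀ j, 0 < l j := by
    intro j
    rw [hlj]
    have h3 : 0 ≤ ∑ i, (d i * ⟪v i, e j⟫ ^ 2) • t i :=
      Finset.sum_nonneg fun i _ => mul_nonneg (hw0 i j) (ht i).le
    refine lt_of_le_of_ne h3 fun h0 => ?_
    have h4 := (Finset.sum_eq_zero_iff_of_nonneg
      (fun i _ => mul_nonneg (hw0 i j) (ht i).le)).1 h0.symm
    have h5 : ∑ i, d i * ⟪v i, e j⟫ ^ 2 = 0 := Finset.sum_eq_zero fun i hi => by
      rcases mul_eq_zero.1 (h4 i hi) with h | h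
      · exact h
      · exact absurd h (ht i).ne'
    rw [hw1] at h5; norm_num at h5
  have hsum : ∑ j, ∑ i, (d i * ⟪v i, e j⟫ ^ 2) • Real.log (t i) = ∑ i, d i * Real.log (t i) := by
    rw [Finset.sum_comm]
    refine Finset.sum_congr rfl fun i _ => ?_
    simp only [smul_eq_mul]
    rw [← Finset.sum_mul, ← Finset.mul_sum, e.sum_sq_inner_left, h.1 i]; simp
  have hdet2 : (Qop v d t).det = Real.exp (∑ j, Real.log (l j)) := by
    rw [hdet, Real.exp_sum]
    exact Finset.prod_congr rfl fun j _ => (Real.exp_log (hlpos j)).symm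
  rw [hdet2, ← hsum]
  refine ⟨Real.exp_le_exp.2 (Finset.sum_le_sum fun j _ => hlog j), fun heq i k hik => ?_⟩
  have heq2 := Real.exp_injective heq
  have heq3 := (Finset.sum_eq_sum_iff_of_le (fun j _ => hlog j)).1 heq2.symm
  have key : ∀ j i, ⟪v i, e j⟫ ≠ 0 → t i = l j := by
    intro j i hne
    have h6 := heq3 j (Finset.mem_univ j)
    rw [hlj j] at h6 ⊢
    have h7 := (strictConcaveOn_log_Ioi.map_sum_eq_iff' (fun i _ => hw0 i j) (hw1 j)
      (fun i _ => ht i)).1 h6.symm i (Finset.mem_univ i)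
    exact h7 (mul_ne_zero (h.2.1 i).ne' (pow_ne_zero 2 hne))
  rw [← e.sum_inner_mul_inner]
  refine Finset.sum_eq_zero fun j _ => ?_
  by_cases h1 : ⟪v i, e j⟫ = 0
  · rw [h1, zero_mul]
  · by_cases h2 : ⟪v k, e j⟫ = 0
    · rw [real_inner_comm (v k) (e j), h2, mul_zero]
    · exact absurd ((key j i h1).trans (key j k h2).symm) hik

def Theta (v : ι → EuclideanSpace ℝ (Fin N)) (d : ι → ℝ) (t : ℝ) (x : EuclideanSpace ℝ (Fin N)) :
    EuclideanSpace ℝ (Fin N) := ∑ i, (d i * Tr t ⟪v i, x⟫) • v i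

def halfs (v : ι → EuclideanSpace ℝ (Fin N)) (t : ℝ) : Set (EuclideanSpace ℝ (Fin N)) :=
  {x | ∀ i, ⟪v i, x⟫ < t}

lemma halfs_open (v : ι → EuclideanSpace ℝ (Fin N)) (t : ℝ) : IsOpen (halfs v t) := by
  rw [halfs, Set.ofPred_forall]
  exact isOpen_iInter_of_finite fun i => isOpen_lt (by fun_prop) (by fun_prop)

lemma Theta_hasFDerivAt (v : ι → EuclideanSpace ℝ (Fin N)) (d : ι → ℝ) (t : ℝ)
    {x : EuclideanSpace ℝ (Fin N)} (hx : x ∈ halfs v t) :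
    HasFDerivAt (Theta v d t) (Qop v d fun i => dTr t ⟪v i, x⟫) x := by
  unfold Theta Qop
  refine HasFDerivAt.fun_sum fun i _ => ?_
  have h1 : HasFDerivAt (fun x => ⟪v i, x⟫) (innerSL ℝ (v i)) x := (innerSL ℝ (v i)).hasFDerivAt
  have h2 := (((Tr_hasDerivAt (hx i)).comp_hasFDerivAt x h1).const_mul (d i)).smul_const (v i)
  refine h2.congr_fderiv ?_
  ext y
  simp [smul_smul]

lemma IsDecomp.Theta_injOn {v : ι → EuclideanSpace ℝ (Fin N)} {d : ι → ℝ} (h : IsDecomp v d)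
    (t : ℝ) : InjOn (Theta v d t) (halfs v t) := by
  intro x hx y hy hxy
  have h1 : ⟪Theta v d t x - Theta v d t y, x - y⟫ = 0 := by rw [hxy]; simp
  have h2 : ⟪Theta v d t x - Theta v d t y, x - y⟫ =
      ∑ i, d i * ((Tr t ⟪v i, x⟫ - Tr t ⟪v i, y⟫) * (⟪v i, x⟫ - ⟪v i, y⟫)) := by
    unfold Theta
    rw [← Finset.sum_sub_distrib, sum_inner]
    refine Finset.sum_congr rfl fun i _ => ?_
    rw [← sub_smul, real_inner_smul_left, inner_sub_right]; ring
  have hnn : ∀ i, 0 ≤ (Tr t ⟪v i, x⟫ - Tr t ⟪v i, y⟫) * (⟪v i, x⟫ - ⟪v i, y⟫) := by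
    intro i
    rcases le_total ⟪v i, x⟫ ⟪v i, y⟫ with hle | hle
    · have := (Tr_strictMonoOn t).monotoneOn (hx i) (hy i) hle
      nlinarith
    · have := (Tr_strictMonoOn t).monotoneOn (hy i) (hx i) hle
      nlinarith
  rw [h1] at h2
  have h3 := (Finset.sum_eq_zero_iff_of_nonneg
    (fun i _ => mul_nonneg (h.2.1 i).le (hnn i))).1 h2.symm
  have h4 : ∀ i, ⟪v i, x⟫ = ⟪v i, y⟫ := by
    intro i
    have h5 := h3 i (Finset.mem_univ i)
    rcases mul_eq_zero.1 h5 with h6 | h6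
    · exact absurd h6 (h.2.1 i).ne'
    rcases mul_eq_zero.1 h6 with h7 | h7
    · exact (Tr_strictMonoOn t).injOn (hx i) (hy i) (sub_eq_zero.1 h7)
    · exact sub_eq_zero.1 h7
  rw [← h.2.2 x, ← h.2.2 y]
  simp_rw [h4]

def gdens (N : ℕ) (x : EuclideanSpace ℝ (Fin N)) : ℝ :=
  (2 * Real.pi) ^ (-(N : ℝ) / 2) * Real.exp (-‖x‖ ^ 2 / 2)

lemma IsDecomp.exp_le {v : ι → EuclideanSpace ℝ (Fin N)} {d : ι → ℝ} (h : IsDecomp v d)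
    (t : ℝ) (x : EuclideanSpace ℝ (Fin N)) :
    (Phi t ^ N)⁻¹ * gdens N x ≤
    Real.exp (∑ i, d i * Real.log (dTr t ⟪v i, x⟫)) * gdens N (Theta v d t x) := by
  have h1 : ∑ i, d i * Real.log (dTr t ⟪v i, x⟫) =
      (∑ i, d i * (Tr t ⟪v i, x⟫) ^ 2) / 2 - ‖x‖ ^ 2 / 2 - N * Real.log (Phi t) := by
    rw [← h.sum_sq x, ← h.sum_d, Finset.sum_mul, Finset.sum_div, Finset.sum_div,
      ← Finset.sum_sub_distrib, ← Finset.sum_sub_distrib]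
    refine Finset.sum_congr rfl fun i _ => ?_
    rw [dTr, Real.log_div (Real.exp_pos _).ne' (Phi_pos t).ne', Real.log_exp]
    ring
  have h2 := h.norm_sq_le (fun i => Tr t ⟪v i, x⟫)
  have h3 : (Phi t ^ N)⁻¹ = Real.exp (-(N * Real.log (Phi t))) := by
    rw [Real.exp_neg, mul_comm, Real.exp_mul, Real.exp_log (Phi_pos t), Real.rpow_natCast]
  rw [h1, h3, gdens, gdens]
  have hc : 0 < (2 * Real.pi) ^ (-(N : ℝ) / 2) := by have := Real.pi_pos; positivity
  rw [mul_left_comm, mul_left_comm (Real.exp _), ← Real.exp_add, ← Real.exp_add]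
  refine mul_le_mul_of_nonneg_left (Real.exp_le_exp.2 ?_) hc.le
  have h4 : Theta v d t x = ∑ i, (d i * Tr t ⟪v i, x⟫) • v i := rfl
  rw [h4]
  linarith

lemma IsDecomp.brascamp_lieb {v : ι → EuclideanSpace ℝ (Fin N)} {d : ι → ℝ} (h : IsDecomp v d)
    (t : ℝ) : (gaussianM N).real (halfs v t) ≤ Phi t ^ N ∧
      (0 < t → (gaussianM N).real (halfs v t) = Phi t ^ N →
        ∀ i k, v i = v k ∨ ⟪v i, v k⟫ = 0) := by
  have hprob := gaussianM_prob N
  set A := halfs v t with hA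
  have hAo : IsOpen A := halfs_open v t
  set Q := fun x => Qop v d fun i => dTr t ⟪v i, x⟫ with hQ
  set F := fun x => |(Q x).det| * gdens N (Theta v d t x) with hF
  set G := fun x => (Phi t ^ N)⁻¹ * gdens N x with hG
  have hg0 : ∀ x, 0 < gdens N x := gaussDens_pos N
  have hdet := fun x => h.det_ge (fun i => dTr t ⟪v i, x⟫) (fun i => dTr_pos t _)
  have hPhi : 0 < Phi t ^ N := pow_pos (Phi_pos t) N
  have hdabs : ∀ x, |(Q x).det| = (Q x).det := fun x =>
    abs_of_nonneg ((Real.exp_pos _).le.trans (hdet x).1)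
  have hGF : ∀ x, G x ≤ F x := by
    intro x
    refine (h.exp_le t x).trans ?_
    simp only [hF]
    rw [hdabs]
    exact mul_le_mul_of_nonneg_right (hdet x).1 (hg0 _).le
  have hchange := lintegral_image_eq_lintegral_abs_det_fderiv_mul volume hAo.measurableSet
    (fun x hx => (Theta_hasFDerivAt v d t hx).hasFDerivWithinAt) (h.Theta_injOn t)
    (fun y => ENNReal.ofReal (gdens N y))
  have hFle : ∫⁻ x in A, ENNReal.ofReal (F x) ≤ 1 := by
    have h1 : ∫⁻ x in A, ENNReal.ofReal (F x) =
        ∫⁻ x in Theta v d t '' A, ENNReal.ofReal (gdens N x) := by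
      rw [hchange]
      refine lintegral_congr fun x => ?_
      rw [hF, ENNReal.ofReal_mul (abs_nonneg _)]
    rw [h1]
    have h2 : ∫⁻ x, ENNReal.ofReal (gdens N x) = 1 := by
      have := hprob.measure_univ
      rw [gaussianM, withDensity_apply _ MeasurableSet.univ, Measure.restrict_univ] at this
      exact this
    rw [← h2]
    exact setLIntegral_le_lintegral _ _
  have hGint : ∫⁻ x in A, ENNReal.ofReal (G x) =
      ENNReal.ofReal ((Phi t ^ N)⁻¹ * (gaussianM N).real A) := by
    have h1 : gaussianM N A = ∫⁻ x in A, ENNReal.ofReal (gdens N x) := by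
      rw [gaussianM, withDensity_apply _ hAo.measurableSet]; rfl
    rw [ENNReal.ofReal_mul (inv_pos.2 hPhi).le, ofReal_measureReal, h1, ← lintegral_const_mul']
    · refine lintegral_congr fun x => ?_
      rw [hG, ENNReal.ofReal_mul (inv_pos.2 hPhi).le]
    · exact ENNReal.ofReal_ne_top
  have hGFint : ∫⁻ x in A, ENNReal.ofReal (G x) ≤ ∫⁻ x in A, ENNReal.ofReal (F x) :=
    lintegral_mono fun x => ENNReal.ofReal_le_ofReal (hGF x)
  refine ⟨?_, ?_⟩
  · have h1 := hGFint.trans hFle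
    rw [hGint, ENNReal.ofReal_le_one, inv_mul_le_iff₀ hPhi, mul_one] at h1
    exact h1
  · intro ht heq i k
    by_contra hcon
    push Not at hcon
    obtain ⟨hne, hin⟩ := hcon
    rw [heq, inv_mul_cancel₀ hPhi.ne', ENNReal.ofReal_one] at hGint
    -- continuity
    have hTc : ∀ i, ContinuousOn (fun x => Tr t ⟪v i, x⟫) A := fun i x hx =>
      (ContinuousAt.comp (f := fun x => ⟪v i, x⟫) (g := Tr t) (Tr_continuousAt (hx i))
        (by fun_prop)).continuousWithinAt
    have hdTc : ∀ i, ContinuousOn (fun x => dTr t ⟪v i, x⟫) A := fun i x hx =>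
      (ContinuousAt.comp (f := fun x => ⟪v i, x⟫) (g := dTr t) (dTr_continuousAt (hx i))
        (by fun_prop)).continuousWithinAt
    have hgc : Continuous (gdens N) := by unfold gdens; fun_prop
    have hThc : ContinuousOn (Theta v d t) A := by unfold Theta; fun_prop
    have hQc : ContinuousOn Q A := by
      simp only [hQ]; unfold Qop; fun_prop
    have hFc : ContinuousOn F A := by
      have h1 : ContinuousOn (fun x => (Q x).det) A :=
        ContinuousLinearMap.continuous_det.comp_continuousOn hQc
      exact h1.abs.mul (hgc.comp_continuousOn hThc)
    have hGc : Continuous G := continuous_const.mul hgc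
    have hae : (fun x => ENNReal.ofReal (G x)) =ᵐ[volume.restrict A]
        fun x => ENNReal.ofReal (F x) := by
      refine ae_eq_of_ae_le_of_lintegral_le
        (Filter.Eventually.of_forall fun x => ENNReal.ofReal_le_ofReal (hGF x)) ?_ ?_ ?_
      · rw [hGint]; exact ENNReal.one_ne_top
      · exact (ENNReal.continuous_ofReal.comp_continuousOn hFc).aemeasurable hAo.measurableSet
      · rw [hGint]; exact hFle
    have hEq : EqOn G F A := by
      refine Measure.eqOn_open_of_ae_eq (μ := volume) ?_ hAo hGc.continuousOn hFc
      filter_upwards [hae] with x hx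
      refine (ENNReal.ofReal_eq_ofReal_iff ?_ ?_).1 hx
      · exact mul_nonneg (inv_pos.2 hPhi).le (hg0 _).le
      · exact mul_nonneg (abs_nonneg _) (hg0 _).le
    have hik1 : ⟪v k, v i⟫ < 1 := by
      refine lt_of_le_of_ne ?_ ?_
      · have := real_inner_le_norm (v k) (v i)
        rw [h.1, h.1] at this; linarith
      · intro h1
        exact hne ((inner_eq_one_iff_of_norm_eq_one (h.1 k) (h.1 i)).1 h1).symm
    refine dTr_not_scale ht hik1 fun s hs0 hst => ?_
    set x := s • v i with hx
    have hxA : x ∈ A := by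
      intro j
      rw [hx, real_inner_smul_right]
      have := real_inner_le_norm (v j) (v i)
      rw [h.1, h.1] at this
      nlinarith
    have hxe := hEq hxA
    have h1 := h.exp_le t x
    have h2 : (Q x).det = Real.exp (∑ i, d i * Real.log (dTr t ⟪v i, x⟫)) := by
      refine le_antisymm ?_ (hdet x).1
      have h3 : (Q x).det * gdens N (Theta v d t x) = G x := by
        rw [hxe, hF]; simp only; rw [hdabs]
      refine le_of_mul_le_mul_right ?_ (hg0 (Theta v d t x))
      rw [h3]; exact h1
    have h4 := (hdet x).2 h2 i k
    by_contra hcon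
    refine hin (h4 ?_)
    have e1 : ⟪v i, x⟫ = s := by
      rw [hx, real_inner_smul_right, real_inner_self_eq_norm_sq, h.1]; simp
    have e2 : ⟪v k, x⟫ = s * ⟪v k, v i⟫ := by rw [hx, real_inner_smul_right]
    rw [e1, e2]
    exact hcon

end BL

/-! ### Stochastic comparison -/

lemma stoch_compare {α β : Type*} [MeasurableSpace α] [MeasurableSpace β] (μ : Measure α)
    (ν : Measure β) [IsProbabilityMeasure μ] [IsProbabilityMeasure ν] (f : α → ℝ) (g : β → ℝ)
    (hf : Measurable f) (hg : Measurable g) (hfi : Integrable f μ) (hgi : Integrable g ν)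
    (h : ∀ t, μ.real {x | f x < t} ≤ ν.real {x | g x < t}) :
    ∫ x, g x ∂ν ≤ ∫ x, f x ∂μ ∧
    (∫ x, f x ∂μ = ∫ x, g x ∂ν → ∃ t > 0, μ.real {x | f x < t} = ν.real {x | g x < t}) := by
  have hle : ∀ t, μ {x | f x < t} ≤ ν {x | g x < t} := fun t =>
    (ENNReal.toReal_le_toReal (measure_ne_top _ _) (measure_ne_top _ _)).1 (h t)
  have hcf : ∀ t, μ {x | t ≤ f x} = 1 - μ {x | f x < t} := fun t => by
    rw [← prob_compl_eq_one_sub (measurableSet_lt hf measurable_const)]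
    congr 1; ext x; simp
  have hcg : ∀ t, ν {x | t ≤ g x} = 1 - ν {x | g x < t} := fun t => by
    rw [← prob_compl_eq_one_sub (measurableSet_lt hg measurable_const)]
    congr 1; ext x; simp
  have hge : ∀ t, ν {x | t ≤ g x} ≤ μ {x | t ≤ f x} := fun t => by
    rw [hcf, hcg]; exact tsub_le_tsub_left (hle t) 1
  have pf : ∫⁻ x, ENNReal.ofReal (max (f x) 0) ∂μ = ∫⁻ t in Ioi 0, μ {x | t ≤ f x} := by
    rw [lintegral_eq_lintegral_meas_le (f := fun x => max (f x) 0) μ (Filter.Eventually.of_forall fun x => le_max_right _ _)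
      (by fun_prop)]
    refine setLIntegral_congr_fun measurableSet_Ioi fun t ht => ?_
    have ht : (0:ℝ) < t := ht
    simp [ht.not_ge]
  have pg : ∫⁻ x, ENNReal.ofReal (max (g x) 0) ∂ν = ∫⁻ t in Ioi 0, ν {x | t ≤ g x} := by
    rw [lintegral_eq_lintegral_meas_le (f := fun x => max (g x) 0) ν (Filter.Eventually.of_forall fun x => le_max_right _ _)
      (by fun_prop)]
    refine setLIntegral_congr_fun measurableSet_Ioi fun t ht => ?_
    have ht : (0:ℝ) < t := ht
    simp [ht.not_ge]
  have nf : ∫⁻ x, ENNReal.ofReal (max (-f x) 0) ∂μ = ∫⁻ t in Ioi 0, μ {x | f x < -t} := by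
    rw [lintegral_eq_lintegral_meas_lt (f := fun x => max (-f x) 0) μ (Filter.Eventually.of_forall fun x => le_max_right _ _)
      (by fun_prop)]
    refine setLIntegral_congr_fun measurableSet_Ioi fun t ht => ?_
    have ht : (0:ℝ) < t := ht
    simp [ht.not_gt, lt_neg]
  have ng : ∫⁻ x, ENNReal.ofReal (max (-g x) 0) ∂ν = ∫⁻ t in Ioi 0, ν {x | g x < -t} := by
    rw [lintegral_eq_lintegral_meas_lt (f := fun x => max (-g x) 0) ν (Filter.Eventually.of_forall fun x => le_max_right _ _)
      (by fun_prop)]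
    refine setLIntegral_congr_fun measurableSet_Ioi fun t ht => ?_
    have ht : (0:ℝ) < t := ht
    simp [ht.not_gt, lt_neg]
  have hfp : Integrable (fun x => max (f x) 0) μ := hfi.pos_part
  have hgp : Integrable (fun x => max (g x) 0) ν := hgi.pos_part
  have hfn : Integrable (fun x => max (-f x) 0) μ := hfi.neg_part
  have hgn : Integrable (fun x => max (-g x) 0) ν := hgi.neg_part
  have e1 : ENNReal.ofReal (∫ x, max (f x) 0 ∂μ) = ∫⁻ t in Ioi 0, μ {x | t ≤ f x} := by
    rw [← pf]; exact ofReal_integral_eq_lintegral_ofReal hfp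
      (Filter.Eventually.of_forall fun x => le_max_right _ _)
  have e2 : ENNReal.ofReal (∫ x, max (g x) 0 ∂ν) = ∫⁻ t in Ioi 0, ν {x | t ≤ g x} := by
    rw [← pg]; exact ofReal_integral_eq_lintegral_ofReal hgp
      (Filter.Eventually.of_forall fun x => le_max_right _ _)
  have e3 : ENNReal.ofReal (∫ x, max (-f x) 0 ∂μ) = ∫⁻ t in Ioi 0, μ {x | f x < -t} := by
    rw [← nf]; exact ofReal_integral_eq_lintegral_ofReal hfn
      (Filter.Eventually.of_forall fun x => le_max_right _ _)
  have e4 : ENNReal.ofReal (∫ x, max (-g x) 0 ∂ν) = ∫⁻ t in Ioi 0, ν {x | g x < -t} := by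
    rw [← ng]; exact ofReal_integral_eq_lintegral_ofReal hgn
      (Filter.Eventually.of_forall fun x => le_max_right _ _)
  have n1 : 0 ≤ ∫ x, max (f x) 0 ∂μ := integral_nonneg fun x => le_max_right _ _
  have n4 : 0 ≤ ∫ x, max (-g x) 0 ∂ν := integral_nonneg fun x => le_max_right _ _
  have l1 : ∫ x, max (g x) 0 ∂ν ≤ ∫ x, max (f x) 0 ∂μ := by
    rw [← ENNReal.ofReal_le_ofReal_iff n1, e1, e2]
    exact lintegral_mono fun t => hge t
  have l2 : ∫ x, max (-f x) 0 ∂μ ≤ ∫ x, max (-g x) 0 ∂ν := by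
    rw [← ENNReal.ofReal_le_ofReal_iff n4, e3, e4]
    exact lintegral_mono fun t => hle _
  have d1 : ∫ x, f x ∂μ = ∫ x, max (f x) 0 ∂μ - ∫ x, max (-f x) 0 ∂μ := by
    rw [← integral_sub hfp hfn]
    refine integral_congr_ae (Filter.Eventually.of_forall fun x => ?_)
    simp only [max_zero_sub_max_neg_zero_eq_self]
  have d2 : ∫ x, g x ∂ν = ∫ x, max (g x) 0 ∂ν - ∫ x, max (-g x) 0 ∂ν := by
    rw [← integral_sub hgp hgn]
    refine integral_congr_ae (Filter.Eventually.of_forall fun x => ?_)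
    simp only [max_zero_sub_max_neg_zero_eq_self]
  refine ⟨by linarith, fun heq => ?_⟩
  have heq1 : ∫ x, max (g x) 0 ∂ν = ∫ x, max (f x) 0 ∂μ := by linarith
  have heq2 : ∫⁻ t in Ioi 0, μ {x | t ≤ f x} ≤ ∫⁻ t in Ioi 0, ν {x | t ≤ g x} := by
    rw [← e1, ← e2, heq1]
  have hanti : Antitone fun t => μ {x | t ≤ f x} := fun a b hab =>
    measure_mono fun x hx => hab.trans hx
  have hae := ae_eq_of_ae_le_of_lintegral_le (μ := volume.restrict (Ioi (0:ℝ)))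
    (Filter.Eventually.of_forall fun t => hge t) (by rw [← e2]; exact ENNReal.ofReal_ne_top)
    hanti.measurable.aemeasurable heq2
  rw [Filter.EventuallyEq, ae_restrict_iff' measurableSet_Ioi] at hae
  have hex : ∃ t, t ∈ Ioi (0:ℝ) ∧ ν {x | t ≤ g x} = μ {x | t ≤ f x} := by
    by_contra hcon
    push Not at hcon
    have h0 : volume (Ioi (0:ℝ)) = 0 := by
      refine measure_mono_null ?_ hae
      intro t ht h2
      exact hcon t ht (h2 ht)
    simp at h0
  obtain ⟨t, ht, he⟩ := hex
  refine ⟨t, ht, ?_⟩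
  rw [hcf, hcg] at he
  have := congrArg (fun z => (1 : ℝ≥0∞) - z) he
  simp only [ENNReal.sub_sub_cancel ENNReal.one_ne_top prob_le_one] at this
  rw [Measure.real, Measure.real, this]

/-! ### Maxima of linear functionals -/

section MX
variable {n : ℕ} {ι : Type*} [Fintype ι] [Nonempty ι]

def mx (u : ι → EuclideanSpace ℝ (Fin n)) (x : EuclideanSpace ℝ (Fin n)) : ℝ :=
  Finset.univ.sup' Finset.univ_nonempty fun i => ⟪u i, x⟫

lemma mx_lt_iff {u : ι → EuclideanSpace ℝ (Fin n)} {x : EuclideanSpace ℝ (Fin n)} {t : ℝ} :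
    mx u x < t ↔ ∀ i, ⟪u i, x⟫ < t := by simp [mx]

lemma mx_le_iff {u : ι → EuclideanSpace ℝ (Fin n)} {x : EuclideanSpace ℝ (Fin n)} {t : ℝ} :
    mx u x ≤ t ↔ ∀ i, ⟪u i, x⟫ ≤ t := by simp [mx]

lemma le_mx (u : ι → EuclideanSpace ℝ (Fin n)) (x : EuclideanSpace ℝ (Fin n)) (i : ι) :
    ⟪u i, x⟫ ≤ mx u x := mx_le_iff.1 le_rfl i

lemma mx_congr_range {κ : Type*} [Fintype κ] [Nonempty κ] {u : ι → EuclideanSpace ℝ (Fin n)}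
    {v : κ → EuclideanSpace ℝ (Fin n)} (h : range u = range v) : mx u = mx v := by
  ext x
  refine eq_of_forall_ge_iff fun t => ?_
  rw [mx_le_iff, mx_le_iff]
  have h1 : (∀ i, ⟪u i, x⟫ ≤ t) ↔ ∀ y ∈ range u, ⟪y, x⟫ ≤ t := by simp
  have h2 : (∀ i, ⟪v i, x⟫ ≤ t) ↔ ∀ y ∈ range v, ⟪y, x⟫ ≤ t := by simp
  rw [h1, h2, h]

lemma mx_cont (u : ι → EuclideanSpace ℝ (Fin n)) : Continuous (mx u) := by
  unfold mx
  exact Continuous.finset_sup'_apply _ fun i _ => by fun_prop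

lemma mx_abs_le {u : ι → EuclideanSpace ℝ (Fin n)} (hu : ∀ i, ‖u i‖ = 1)
    (x : EuclideanSpace ℝ (Fin n)) : |mx u x| ≤ ‖x‖ := by
  have h : ∀ i, |⟪u i, x⟫| ≤ ‖x‖ := fun i => by
    have := abs_real_inner_le_norm (u i) x
    rwa [hu, one_mul] at this
  rw [abs_le]
  obtain ⟨i⟩ := ‹Nonempty ι›
  exact ⟨(abs_le.1 (h i)).1.trans (le_mx u x i), mx_le_iff.2 fun i => (abs_le.1 (h i)).2⟩

lemma mx_integrable {u : ι → EuclideanSpace ℝ (Fin n)} (hu : ∀ i, ‖u i‖ = 1) :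
    Integrable (mx u) (gaussianM n) :=
  (gaussianM_norm_integrable n).mono' (mx_cont u).aestronglyMeasurable
    (Filter.Eventually.of_forall (mx_abs_le hu))

end MX

lemma mx_compare {N : ℕ} [NeZero N] {ι : Type*} [Fintype ι] [Nonempty ι]
    {v : ι → EuclideanSpace ℝ (Fin N)} {d : ι → ℝ} (h : IsDecomp v d)
    (b : OrthonormalBasis (Fin N) ℝ (EuclideanSpace ℝ (Fin N))) :
    ∫ x, mx b x ∂(gaussianM N) ≤ ∫ x, mx v x ∂(gaussianM N) ∧
    (∫ x, mx v x ∂(gaussianM N) = ∫ x, mx b x ∂(gaussianM N) →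
      ∀ i k, v i = v k ∨ ⟪v i, v k⟫ = 0) := by
  have := gaussianM_prob N
  have hv : ∀ t, {x | mx v x < t} = halfs v t := fun t => by
    ext x; simp [mx_lt_iff, halfs]
  have hb : ∀ t, (gaussianM N).real {x | mx b x < t} = Phi t ^ N := fun t => by
    rw [← gaussianM_orthant N b t]
    congr 1; ext x; simp [mx_lt_iff, real_inner_comm]
  have key := stoch_compare (gaussianM N) (gaussianM N) (mx v) (mx b) (mx_cont v).measurable
    (mx_cont _).measurable (mx_integrable h.1) (mx_integrable b.norm_eq_one) (fun t => by
      rw [hv, hb]; exact (h.brascamp_lieb t).1)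
  refine ⟨key.1, fun heq => ?_⟩
  obtain ⟨t, ht, he⟩ := key.2 heq
  rw [hv, hb] at he
  exact (h.brascamp_lieb t).2 ht he

lemma ob_decomp {N : ℕ} (b : OrthonormalBasis (Fin N) ℝ (EuclideanSpace ℝ (Fin N))) :
    IsDecomp b (fun _ => 1) := by
  refine ⟨b.norm_eq_one, fun _ => one_pos, fun x => ?_⟩
  simpa using b.sum_repr' x

/-! ### Lifting -/

section Lift
variable {n : ℕ}

def lft (u : EuclideanSpace ℝ (Fin n)) : EuclideanSpace ℝ (Fin (n + 1)) :=
  liftV (√(n / (n + 1) : ℝ) • u) (√(1 / (n + 1) : ℝ))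

lemma inner_lft (hn : 1 ≤ n) (u : EuclideanSpace ℝ (Fin n)) (y : EuclideanSpace ℝ (Fin (n + 1))) :
    ⟪lft u, y⟫ = √(1 / (n + 1) : ℝ) * y 0 + √(n / (n + 1) : ℝ) * ⟪u, tailV y⟫ := by
  rw [lft, real_inner_comm, inner_liftV, real_inner_smul_right, real_inner_comm u]
  ring

lemma inner_lft_lft (hn : 1 ≤ n) (u v : EuclideanSpace ℝ (Fin n)) :
    ⟪lft u, lft v⟫ = 1 / (n + 1) + n / (n + 1) * ⟪u, v⟫ := by
  rw [lft, lft, inner_liftV_liftV, real_inner_smul_left, real_inner_smul_right, ← mul_assoc,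
    Real.mul_self_sqrt (by positivity), Real.mul_self_sqrt (by positivity)]

lemma norm_lft (hn : 1 ≤ n) {u : EuclideanSpace ℝ (Fin n)} (hu : ‖u‖ = 1) : ‖lft u‖ = 1 := by
  have h : ‖lft u‖ ^ 2 = 1 := by
    rw [← real_inner_self_eq_norm_sq, inner_lft_lft hn, real_inner_self_eq_norm_sq, hu]
    field_simp
    ring
  rw [← sq_eq_sq₀ (norm_nonneg _) one_pos.le, h]; norm_num

lemma lft_inj (hn : 1 ≤ n) {u v : EuclideanSpace ℝ (Fin n)} (h : lft u = lft v) : u = v := by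
  have h1 := congrArg tailV h
  rw [lft, lft, tailV_liftV, tailV_liftV] at h1
  have h2 : √(n / (n + 1) : ℝ) ≠ 0 := by
    have : (0:ℝ) < n := by exact_mod_cast hn
    positivity
  exact smul_right_injective _ h2 h1

lemma mx_lft (hn : 1 ≤ n) {ι : Type*} [Fintype ι] [Nonempty ι] (u : ι → EuclideanSpace ℝ (Fin n))
    (y : EuclideanSpace ℝ (Fin (n + 1))) :
    mx (fun i => lft (u i)) y = √(1 / (n + 1) : ℝ) * y 0 + √(n / (n + 1) : ℝ) * mx u (tailV y) := by
  have h2 : 0 < √(n / (n + 1) : ℝ) := by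
    have : (0:ℝ) < n := by exact_mod_cast hn
    positivity
  refine eq_of_forall_ge_iff fun t => ?_
  rw [mx_le_iff, ← le_sub_iff_add_le', ← le_div_iff₀' h2, mx_le_iff]
  refine forall_congr' fun i => ?_
  rw [inner_lft hn, le_div_iff₀' h2, le_sub_iff_add_le']

lemma integral_mx_lft (hn : 1 ≤ n) {ι : Type*} [Fintype ι] [Nonempty ι]
    (u : ι → EuclideanSpace ℝ (Fin n)) (hu : ∀ i, ‖u i‖ = 1) :
    ∫ y, mx (fun i => lft (u i)) y ∂(gaussianM (n + 1)) =
      √(n / (n + 1) : ℝ) * ∫ x, mx u x ∂(gaussianM n) := by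
  simp_rw [mx_lft hn]
  have h0 : ∀ y : EuclideanSpace ℝ (Fin (n+1)), y 0 = ⟪y, EuclideanSpace.single 0 1⟫ := by
    intro y; simp [EuclideanSpace.inner_single_right]
  have hi0 : Integrable (fun y : EuclideanSpace ℝ (Fin (n+1)) => y 0) (gaussianM (n+1)) := by
    refine (gaussianM_norm_integrable (n+1)).mono' (by fun_prop)
      (Filter.Eventually.of_forall fun y => PiLp.norm_apply_le y 0)
  have hmap := gaussianM_tail n
  have hi1 : Integrable (fun y => mx u (tailV y)) (gaussianM (n+1)) := by
    have := mx_integrable hu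
    rw [← hmap] at this
    exact this.comp_measurable continuous_tailV.measurable
  rw [integral_add (hi0.const_mul _) (hi1.const_mul _), integral_const_mul, integral_const_mul]
  simp_rw [h0]
  rw [gaussianM_inner_integral, mul_zero, zero_add]
  conv_rhs => rw [← hmap, integral_map continuous_tailV.aemeasurable
    (mx_cont u).aestronglyMeasurable]

/-- regular simplices lift to orthonormal bases -/
lemma reg_lift (hn : 1 ≤ n) {w : Fin (n + 1) → EuclideanSpace ℝ (Fin n)} (hw : IsRegVerts w) :
    ∃ b : OrthonormalBasis (Fin (n + 1)) ℝ (EuclideanSpace ℝ (Fin (n + 1))),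
      ∀ i, b i = lft (w i) := by
  have hon : Orthonormal ℝ (fun i => lft (w i)) := by
    refine ⟨fun i => norm_lft hn (hw.1 i), fun i j hij => ?_⟩
    change ⟪lft (w i), lft (w j)⟫ = 0
    rw [inner_lft_lft hn, hw.2 i j hij]
    have : (0:ℝ) < n := by exact_mod_cast hn
    field_simp
    ring
  have hc : Fintype.card (Fin (n+1)) = Module.finrank ℝ (EuclideanSpace ℝ (Fin (n+1))) := by simp
  let b := (basisOfOrthonormalOfCardEqFinrank hon hc).toOrthonormalBasis (by simpa using hon)
  exact ⟨b, fun i => by simp [b]⟩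

lemma lift_decomp (hn : 1 ≤ n) {ι : Type*} [Fintype ι] {u : ι → EuclideanSpace ℝ (Fin n)}
    {c : ι → ℝ} (h : IsDecomp u c) (h0 : ∑ i, c i • u i = 0) :
    IsDecomp (fun i => lft (u i)) (fun i => ((n : ℝ) + 1) / n * c i) := by
  have hnp : (0:ℝ) < n := by exact_mod_cast hn
  refine ⟨fun i => norm_lft hn (h.1 i), fun i => mul_pos (by positivity) (h.2.1 i), fun y => ?_⟩
  have hs1 : √(1 / (n + 1) : ℝ) * √(1 / (n + 1) : ℝ) = 1 / (n+1) :=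
    Real.mul_self_sqrt (by positivity)
  have hs2 : √(n / (n + 1) : ℝ) * √(n / (n + 1) : ℝ) = n / (n+1) :=
    Real.mul_self_sqrt (by positivity)
  have hs : ∀ z, ∑ i, c i * ⟪u i, z⟫ = 0 := fun z => by
    have := congrArg (fun q => ⟪q, z⟫) h0
    simpa [sum_inner, real_inner_smul_left] using this
  refine ext_inner_left ℝ fun z => ?_
  have e1 : ⟪z, ∑ i, (((n : ℝ) + 1) / n * c i * ⟪lft (u i), y⟫) • lft (u i)⟫ =
      ∑ i, ((n : ℝ) + 1) / n * c i * (√(1 / (n + 1) : ℝ) * y 0 +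
        √(n / (n + 1) : ℝ) * ⟪u i, tailV y⟫) * (√(1 / (n + 1) : ℝ) * z 0 +
        √(n / (n + 1) : ℝ) * ⟪u i, tailV z⟫) := by
    rw [inner_sum]
    refine Finset.sum_congr rfl fun i _ => ?_
    rw [real_inner_smul_right, real_inner_comm _ z, inner_lft hn, inner_lft hn]
  have e2 : ∀ i, ((n : ℝ) + 1) / n * c i * (√(1 / (n + 1) : ℝ) * y 0 +
        √(n / (n + 1) : ℝ) * ⟪u i, tailV y⟫) * (√(1 / (n + 1) : ℝ) * z 0 +
        √(n / (n + 1) : ℝ) * ⟪u i, tailV z⟫) =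
      ((n : ℝ) + 1) / n * (1 / (n + 1)) * y 0 * z 0 * c i
      + ((n : ℝ) + 1) / n * √(1 / (n + 1) : ℝ) * √(n / (n + 1) : ℝ) * y 0 * (c i * ⟪u i, tailV z⟫)
      + ((n : ℝ) + 1) / n * √(1 / (n + 1) : ℝ) * √(n / (n + 1) : ℝ) * z 0 * (c i * ⟪u i, tailV y⟫)
      + ((n : ℝ) + 1) / n * (n / (n+1)) * (c i * ⟪u i, tailV y⟫ * ⟪u i, tailV z⟫) := by
    intro i
    generalize √(1 / ((n:ℝ) + 1)) = a at hs1 ⊢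
    generalize √((n:ℝ) / (n + 1)) = b at hs2 ⊢
    linear_combination (((n:ℝ)+1)/n * c i * y 0 * z 0) * hs1 +
      (((n:ℝ)+1)/n * c i * ⟪u i, tailV y⟫ * ⟪u i, tailV z⟫) * hs2
  have e3 : ∑ i, c i * ⟪u i, tailV y⟫ * ⟪u i, tailV z⟫ = ⟪tailV y, tailV z⟫ := by
    conv_rhs => rw [← h.2.2 (tailV y)]
    rw [sum_inner]
    exact Finset.sum_congr rfl fun i _ => by rw [real_inner_smul_left]
  have e4 : ⟪z, y⟫ = y 0 * z 0 + ⟪tailV y, tailV z⟫ := by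
    simp [PiLp.inner_apply, Fin.sum_univ_succ, tailV, mul_comm]
  rw [e1, e4, Finset.sum_congr rfl fun i _ => e2 i, Finset.sum_add_distrib, Finset.sum_add_distrib,
    Finset.sum_add_distrib, ← Finset.mul_sum, ← Finset.mul_sum, ← Finset.mul_sum, ← Finset.mul_sum,
    hs, hs, e3, h.sum_d]
  field_simp
  ring

lemma reg_integral_eq (hn : 1 ≤ n) {w w' : Fin (n + 1) → EuclideanSpace ℝ (Fin n)}
    (hw : IsRegVerts w) (hw' : IsRegVerts w') :
    ∫ x, mx w x ∂(gaussianM n) = ∫ x, mx w' x ∂(gaussianM n) := by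
  obtain ⟨b, hb⟩ := reg_lift hn hw
  obtain ⟨b', hb'⟩ := reg_lift hn hw'
  have h1 := (mx_compare (ob_decomp b) b').1
  have h2 := (mx_compare (ob_decomp b') b).1
  have h3 := le_antisymm h1 h2
  have hbe : (b : Fin (n+1) → _) = fun i => lft (w i) := funext hb
  have hbe' : (b' : Fin (n+1) → _) = fun i => lft (w' i) := funext hb'
  rw [hbe, hbe', integral_mx_lft hn _ hw.1, integral_mx_lft hn _ hw'.1] at h3
  have h4 : √(n / (n + 1) : ℝ) ≠ 0 := by
    have : (0:ℝ) < n := by exact_mod_cast hn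
    positivity
  exact (mul_left_cancel₀ h4 h3).symm

theorem main_compare (hn : 1 ≤ n) {w : Fin (n + 1) → EuclideanSpace ℝ (Fin n)}
    (hw : IsRegVerts w) {ι : Type*} [Fintype ι] [Nonempty ι] {u : ι → EuclideanSpace ℝ (Fin n)}
    {c : ι → ℝ} (h : IsDecomp u c) (h0 : ∑ i, c i • u i = 0) :
    ∫ x, mx w x ∂(gaussianM n) ≤ ∫ x, mx u x ∂(gaussianM n) ∧
    (∫ x, mx u x ∂(gaussianM n) = ∫ x, mx w x ∂(gaussianM n) →
      ∃ v : Fin (n + 1) → EuclideanSpace ℝ (Fin n), IsRegVerts v ∧ range v = range u) := by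
  have hnp : (0:ℝ) < n := by exact_mod_cast hn
  obtain ⟨b, hb⟩ := reg_lift hn hw
  have hbe : (b : Fin (n+1) → _) = fun i => lft (w i) := funext hb
  have hd := lift_decomp hn h h0
  have hc := mx_compare hd b
  rw [hbe, integral_mx_lft hn _ hw.1, integral_mx_lft hn _ h.1] at hc
  have h4 : 0 < √(n / (n + 1) : ℝ) := by positivity
  refine ⟨le_of_mul_le_mul_left hc.1 h4, fun heq => ?_⟩
  have hort := hc.2 (by rw [heq])
  classical
  have hon : Orthonormal ℝ (fun r : range u => lft (r : EuclideanSpace ℝ (Fin n))) := by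
    refine ⟨?_, ?_⟩
    · rintro ⟨_, i, rfl⟩
      exact norm_lft hn (h.1 i)
    · rintro ⟨_, i, rfl⟩ ⟨_, k, rfl⟩ hik
      rcases hort i k with h1 | h1
      · exact absurd (Subtype.ext (lft_inj hn h1)) hik
      · exact h1
  have hspan : ⊤ ≤ Submodule.span ℝ (range fun r : range u => lft (r : EuclideanSpace ℝ (Fin n))) := by
    intro y _
    rw [← hd.2.2 y]
    refine Submodule.sum_mem _ fun i _ => Submodule.smul_mem _ _ (Submodule.subset_span ?_)
    exact ⟨⟨u i, i, rfl⟩, rfl⟩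
  have hcard := Module.finrank_eq_card_basis (Module.Basis.mk hon.linearIndependent hspan)
  have e : Fin (n + 1) ≃ range u := by
    refine Fintype.equivOfCardEq ?_
    rw [← hcard]; simp
  refine ⟨fun j => e j, ⟨fun j => ?_, fun i j hij => ?_⟩, ?_⟩
  · obtain ⟨i, hi⟩ := (e j).2
    change ‖((e j : range u) : EuclideanSpace ℝ (Fin n))‖ = 1
    rw [← hi]; exact h.1 i
  · have h5 := hon.2 (fun hh => hij (e.injective hh) : e i ≠ e j)
    change ⟪lft (e i : EuclideanSpace ℝ (Fin n)), lft (e j : EuclideanSpace ℝ (Fin n))⟫ = 0 at h5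
    rw [inner_lft_lft hn] at h5
    field_simp at h5 ⊢
    linarith
  · ext x
    constructor
    · rintro ⟨j, rfl⟩
      exact (e j).2
    · intro hx
      exact ⟨e.symm ⟨x, hx⟩, by simp⟩

end Lift

/-! ### John decompositions -/

lemma isCompact_convexHull_of_compact {V : Type*} [NormedAddCommGroup V] [NormedSpace ℝ V]
    [FiniteDimensional ℝ V] {s : Set V} (hs : IsCompact s) : IsCompact (convexHull ℝ s) := by
  rcases s.eq_empty_or_nonempty with rfl | ⟨x0, hx0⟩
  · simp
  set d := Module.finrank ℝ V + 1
  have hF : Continuous fun p : (Fin d → ℝ) × (Fin d → V) => ∑ i, p.1 i • p.2 i := by fun_prop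
  have hc : IsCompact (stdSimplex ℝ (Fin d) ×ˢ Set.pi univ fun _ : Fin d => s) :=
    (isCompact_stdSimplex ℝ (Fin d)).prod (isCompact_univ_pi fun _ => hs)
  convert hc.image hF
  ext x
  constructor
  · intro hx
    obtain ⟨κ, _, z, w, hz, hai, hw, hw1, hwT⟩ := eq_pos_convex_span_of_mem_convexHull hx
    have hcard : Fintype.card κ ≤ Fintype.card (Fin d) := by
      rw [Fintype.card_fin]
      exact hai.card_le_finrank_succ.trans (by
        have := Submodule.finrank_le (vectorSpan ℝ (range z))
        omega)
    obtain ⟨e⟩ := Function.Embedding.nonempty_of_card_le hcard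
    have hz' : ∀ j, Function.extend e z (fun _ => x0) j ∈ s := fun j => by
      by_cases hj : ∃ a, e a = j
      · obtain ⟨a, rfl⟩ := hj
        rw [e.injective.extend_apply]; exact hz ⟨a, rfl⟩
      · rw [Function.extend_apply' _ _ _ hj]; exact hx0
    have hw0 : ∀ j, (¬ ∃ a, e a = j) → Function.extend e w 0 j = 0 := fun j hj => by
      rw [Function.extend_apply' _ _ _ hj]; rfl
    refine ⟨(Function.extend e w 0, Function.extend e z fun _ => x0), ⟨⟨fun j => ?_, ?_⟩, ?_⟩, ?_⟩
    · by_cases hj : ∃ a, e a = j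
      · obtain ⟨a, rfl⟩ := hj
        simp only [e.injective.extend_apply]; exact (hw a).le
      · simp only [hw0 j hj]; exact le_rfl
    · rw [← hw1]
      symm
      refine Finset.sum_of_injOn e e.injective.injOn (by simp) (fun j _ hj => ?_) (fun a _ => ?_)
      · exact hw0 j (by simpa using hj)
      · simp [e.injective.extend_apply]
    · intro j _
      exact hz' j
    · simp only
      rw [← hwT]
      symm
      refine Finset.sum_of_injOn e e.injective.injOn (by simp) (fun j _ hj => ?_) (fun a _ => ?_)
      · rw [hw0 j (by simpa using hj), zero_smul]
      · simp [e.injective.extend_apply]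
  · rintro ⟨⟨w, z⟩, ⟨⟨h1, h2⟩, h3⟩, rfl⟩
    exact (convex_convexHull ℝ s).sum_mem (fun i _ => h1 i) h2
      fun i _ => subset_convexHull ℝ s (h3 i (mem_univ i))

section JohnDecomp
variable {n : ℕ}

lemma sep_unit {K : Set (EuclideanSpace ℝ (Fin n))} (hc : Convex ℝ K) (hcl : IsClosed K)
    (hne : K.Nonempty) {p : EuclideanSpace ℝ (Fin n)} (hp : p ∉ K) :
    ∃ v : EuclideanSpace ℝ (Fin n), ‖v‖ = 1 ∧ ∃ s, s < ⟪p, v⟫ ∧ ∀ y ∈ K, ⟪y, v⟫ < s := by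
  obtain ⟨f, s, hf, hs⟩ := geometric_hahn_banach_closed_point hc hcl hp
  obtain ⟨v, rfl⟩ := (InnerProductSpace.toDual ℝ (EuclideanSpace ℝ (Fin n))).surjective f
  simp only [InnerProductSpace.toDual_apply_apply] at hf hs
  have hv : v ≠ 0 := by
    rintro rfl
    obtain ⟨y, hy⟩ := hne
    have := hf y hy
    simp at this hs
    linarith
  have hv' : 0 < ‖v‖ := norm_pos_iff.2 hv
  refine ⟨‖v‖⁻¹ • v, by simp [norm_smul, hv], ‖v‖⁻¹ * s, ?_, fun y hy => ?_⟩
  · rw [real_inner_smul_right, real_inner_comm]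
    exact mul_lt_mul_of_pos_left hs (by positivity)
  · rw [real_inner_smul_right, real_inner_comm]
    exact mul_lt_mul_of_pos_left (hf y hy) (by positivity)

lemma inner_toLin (M : Matrix (Fin n) (Fin n) ℝ) (x y : EuclideanSpace ℝ (Fin n)) :
    ⟪M.toEuclideanLin x, y⟫ = ∑ i, ∑ j, M i j * x j * y i := by
  simp only [PiLp.inner_apply, Matrix.ofLp_toLpLin, Matrix.toLin'_apply, Matrix.mulVec, dotProduct]
  refine Finset.sum_congr rfl fun i _ => ?_
  simp [Finset.mul_sum, mul_comm]

/-- The point `(u ⊗ u, u)`. -/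
def PP (u : EuclideanSpace ℝ (Fin n)) : (Fin n → Fin n → ℝ) × EuclideanSpace ℝ (Fin n) :=
  (fun i j => u i * u j, u)

lemma PP_cont : Continuous (PP : EuclideanSpace ℝ (Fin n) → _) := by
  unfold PP
  fun_prop

lemma dual_formula (f : ((Fin n → Fin n → ℝ) × EuclideanSpace ℝ (Fin n)) →L[ℝ] ℝ) :
    ∃ (M : Matrix (Fin n) (Fin n) ℝ) (b : EuclideanSpace ℝ (Fin n)), ∀ A x,
      f (A, x) = ∑ i, ∑ j, M i j * A i j + ⟪b, x⟫ := by
  obtain ⟨b, hb⟩ := (InnerProductSpace.toDual ℝ (EuclideanSpace ℝ (Fin n))).surjective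
    (f.comp (ContinuousLinearMap.inr ℝ _ _))
  refine ⟨fun i j => f (Pi.single i (Pi.single j 1), 0), b, fun A x => ?_⟩
  have h1 : f (A, x) = f (A, 0) + f (0, x) := by rw [← map_add]; simp
  have h2 : f (0, x) = ⟪b, x⟫ := by
    have := congrArg (fun g => g x) hb
    simpa using this.symm
  have h3 : A = ∑ i, ∑ j, A i j • (Pi.single i (Pi.single j 1) : Fin n → Fin n → ℝ) := by
    ext a c
    simp [Finset.sum_apply, Pi.single_apply, ite_apply]
  have h4 : f (A, 0) = ∑ i, ∑ j, f (Pi.single i (Pi.single j 1), 0) * A i j := by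
    have : f (A, 0) = (f.comp (ContinuousLinearMap.inl ℝ _ _)) A := by simp
    rw [this]
    conv_lhs => rw [h3]
    simp [map_sum, mul_comm]
  rw [h1, h2, h4]

lemma decomp_or_sep (hn : 1 ≤ n) {U : Set (EuclideanSpace ℝ (Fin n))} (hU : IsCompact U)
    (hs : ∀ u ∈ U, ‖u‖ = 1) :
    (∃ (ι : Type) (_ : Fintype ι) (_ : Nonempty ι) (u : ι → EuclideanSpace ℝ (Fin n)) (c : ι → ℝ),
      (∀ i, u i ∈ U) ∧ IsDecomp u c ∧ ∑ i, c i • u i = 0) ∨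
    ∃ (M : Matrix (Fin n) (Fin n) ℝ) (b : EuclideanSpace ℝ (Fin n)), 0 < M.trace ∧
      ∀ u ∈ U, ⟪M.toEuclideanLin u, u⟫ + ⟪b, u⟫ < 0 := by
  have hnp : (0:ℝ) < n := by exact_mod_cast hn
  set T : (Fin n → Fin n → ℝ) × EuclideanSpace ℝ (Fin n) :=
    (fun i j => if i = j then 1 / (n:ℝ) else 0, 0) with hT
  by_cases hmem : T ∈ convexHull ℝ (PP '' U)
  · left
    obtain ⟨κ, _, z, w, hz, -, hw, hw1, hwT⟩ := eq_pos_convex_span_of_mem_convexHull hmem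
    have hzz : ∀ i, ∃ u ∈ U, PP u = z i := fun i => hz ⟨i, rfl⟩
    choose u hu huz using hzz
    have e1 : ∀ a b, ∑ i, w i * (u i a * u i b) = if a = b then 1 / (n:ℝ) else 0 := fun a b => by
      have := congrArg (fun q => q.1 a b) hwT
      simpa [Prod.fst_sum, Finset.sum_apply, ← huz, PP, hT] using this
    have e2 : ∑ i, w i • u i = 0 := by
      have := congrArg (fun q => q.2) hwT
      simpa [Prod.snd_sum, ← huz, PP, hT] using this
    have hne : Nonempty κ := by
      by_contra hcon
      rw [not_nonempty_iff] at hcon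
      simp at hw1
    let e := Fintype.equivFin κ
    refine ⟨Fin (Fintype.card κ), inferInstance, e.symm.nonempty, fun i => u (e.symm i),
      fun i => n * w (e.symm i), fun i => hu _, ⟨fun i => hs _ (hu _),
      fun i => mul_pos hnp (hw _), fun x => ?_⟩, ?_⟩
    · rw [Equiv.sum_comp e.symm (fun i => (n * w i * ⟪u i, x⟫) • u i)]
      ext b
      simp only [WithLp.ofLp_sum, Finset.sum_apply, PiLp.smul_apply, smul_eq_mul, PiLp.inner_apply]
      have : ∀ i, n * w i * (∑ a, ⟪u i a, x a⟫) * u i b =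
          ∑ a, n * x a * (w i * (u i a * u i b)) := fun i => by
        rw [Finset.mul_sum, Finset.sum_mul]
        refine Finset.sum_congr rfl fun a _ => ?_
        simp; ring
      rw [Finset.sum_congr rfl fun i _ => this i, Finset.sum_comm]
      simp_rw [← Finset.mul_sum, e1]
      simp
      field_simp
    · rw [Equiv.sum_comp e.symm (fun i => (n * w i) • u i)]
      simp_rw [mul_smul, ← Finset.smul_sum, e2, smul_zero]
  · right
    have hcpt : IsCompact (convexHull ℝ (PP '' U)) := isCompact_convexHull_of_compact (hU.image PP_cont)
    obtain ⟨f, s, hf, hfs⟩ := geometric_hahn_banach_closed_point (convex_convexHull ℝ _)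
      hcpt.isClosed hmem
    obtain ⟨M, b, hMb⟩ := dual_formula f
    refine ⟨M - s • (1 : Matrix (Fin n) (Fin n) ℝ), b, ?_, fun u hu => ?_⟩
    · rw [hT, hMb] at hfs
      simp [← Finset.sum_mul] at hfs
      simp [Matrix.trace_sub, Matrix.trace_smul]
      have : ∑ i, M i i = M.trace := rfl
      rw [this, ← div_eq_mul_inv, lt_div_iff₀ hnp] at hfs
      exact hfs
    · have h1 := hf (PP u) (subset_convexHull ℝ _ ⟨u, hu, rfl⟩)
      rw [PP, hMb] at h1
      have h2 : ⟪M.toEuclideanLin u, u⟫ = ∑ i, ∑ j, M i j * (u i * u j) := by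
        rw [inner_toLin]
        exact Finset.sum_congr rfl fun i _ => Finset.sum_congr rfl fun j _ => by ring
      have h3 : (M - s • (1 : Matrix (Fin n) (Fin n) ℝ)).toEuclideanLin u =
          M.toEuclideanLin u - s • u := by
        rw [map_sub, map_smul]
        simp [Matrix.toEuclideanLin, Matrix.toLpLin_one]
      rw [h3, inner_sub_left, real_inner_smul_left, real_inner_self_eq_norm_sq, hs u hu, h2]
      linarith

lemma aff_exists (M : Matrix (Fin n) (Fin n) ℝ) (b : EuclideanSpace ℝ (Fin n)) (hM : M.det ≠ 0) :
    ∃ f : EuclideanSpace ℝ (Fin n) ≃ᵃ[ℝ] EuclideanSpace ℝ (Fin n),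
      (∀ x, f x = M.toEuclideanLin x + b) ∧
      ∀ s, volume (f '' s) = ENNReal.ofReal |M.det| * volume s := by
  have hd : LinearMap.det M.toEuclideanLin = M.det := by
    simp [Matrix.toEuclideanLin]
  let L := LinearEquiv.ofIsUnitDet (f := M.toEuclideanLin)
    (v := (EuclideanSpace.basisFun (Fin n) ℝ).toBasis)
    (v' := (EuclideanSpace.basisFun (Fin n) ℝ).toBasis) (by
      rw [LinearMap.det_toMatrix, hd]; exact isUnit_iff_ne_zero.2 hM)
  let f := L.toAffineEquiv.trans (AffineEquiv.constVAdd ℝ (EuclideanSpace ℝ (Fin n)) b)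
  have hf : ∀ x, f x = M.toEuclideanLin x + b := fun x => by
    simp [f, L, add_comm]
  refine ⟨f, hf, fun s => ?_⟩
  have : f '' s = (fun y => y + b) '' (M.toEuclideanLin '' s) := by
    rw [image_image]
    exact image_congr fun x _ => hf x
  rw [this, image_add_right, measure_preimage_add_right, Measure.addHaar_image_linearMap, hd]

lemma det_gt (M : Matrix (Fin n) (Fin n) ℝ) (hM : 0 < M.trace) :
    ∃ δ : ℝ, 0 < δ ∧ ∀ ε : ℝ, 0 < ε → ε < δ → 1 < (1 + ε • M).det := by
  set p := (Matrix.det (1 + (Polynomial.X : Polynomial ℝ) • M.map Polynomial.C)).divX.divX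
  have hcont : Continuous fun ε : ℝ => M.trace + p.eval ε * ε := by fun_prop
  have h0 : ∀ᶠ ε in nhds (0:ℝ), 0 < M.trace + p.eval ε * ε :=
    hcont.continuousAt.eventually (lt_mem_nhds (by simpa using hM))
  obtain ⟨δ, hδ, h⟩ := Metric.eventually_nhds_iff.1 h0
  refine ⟨δ, hδ, fun ε he hed => ?_⟩
  have h1 := h (y := ε) (by rw [Real.dist_eq, sub_zero, abs_of_pos he]; exact hed)
  rw [Matrix.det_one_add_smul]
  nlinarith [mul_pos he h1]

/-- A sequence version. -/
lemma det_seq (M : Matrix (Fin n) (Fin n) ℝ) (hM : 0 < M.trace) :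
    ∃ ε : ℕ → ℝ, (∀ k, 0 < ε k) ∧ Filter.Tendsto ε Filter.atTop (nhds 0) ∧
      ∀ k, 1 < (1 + ε k • M).det := by
  obtain ⟨δ, hδ, h⟩ := det_gt M hM
  refine ⟨fun k => δ / 2 * (1 / ((k:ℝ) + 1)), fun k => by positivity, ?_, fun k => ?_⟩
  · simpa using (tendsto_one_div_add_atTop_nhds_zero_nat (𝕜 := ℝ)).const_mul (δ / 2)
  · refine h _ (by positivity) ?_
    have : 1 / ((k:ℝ) + 1) ≤ 1 := by
      rw [div_le_one (by positivity)]; linarith [(Nat.cast_nonneg k : (0:ℝ) ≤ k)]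
    nlinarith

lemma one_add_smul_toLin (M : Matrix (Fin n) (Fin n) ℝ) (ε : ℝ) (x : EuclideanSpace ℝ (Fin n)) :
    (1 + ε • M).toEuclideanLin x = x + ε • M.toEuclideanLin x := by
  rw [map_add, map_smul]
  simp [Matrix.toEuclideanLin, Matrix.toLpLin_one]

lemma volB_pos : 0 < volume (closedBall (0 : EuclideanSpace ℝ (Fin n)) 1) :=
  measure_closedBall_pos _ _ one_pos

lemma volB_lt : volume (closedBall (0 : EuclideanSpace ℝ (Fin n)) 1) ≠ ⊤ :=
  measure_closedBall_lt_top.ne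

theorem john_decomp (hn : 1 ≤ n) {K : Set (EuclideanSpace ℝ (Fin n))} (hKcomp : IsCompact K)
    (hKconv : Convex ℝ K) (hJ : IsJohnEllipsoid (closedBall 0 1) K) :
    ∃ (ι : Type) (_ : Fintype ι) (_ : Nonempty ι) (u : ι → EuclideanSpace ℝ (Fin n)) (c : ι → ℝ),
      (∀ i, ∀ y ∈ K, ⟪u i, y⟫ ≤ 1) ∧ IsDecomp u c ∧ ∑ i, c i • u i = 0 := by
  set U : Set (EuclideanSpace ℝ (Fin n)) := sphere 0 1 ∩ {v | ∀ y ∈ K, ⟪v, y⟫ ≤ 1} with hUdef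
  have hcl : IsClosed {v : EuclideanSpace ℝ (Fin n) | ∀ y ∈ K, ⟪v, y⟫ ≤ 1} := by
    simp only [ofPred_forall]
    exact isClosed_biInter fun y _ => isClosed_le (by fun_prop) continuous_const
  have hU : IsCompact U := (isCompact_sphere 0 1).inter_right hcl
  rcases decomp_or_sep hn hU (fun u hu => by simpa using hu.1) with
    ⟨ι, _, _, u, c, h1, h2, h3⟩ | ⟨M, b, hM, hlt⟩
  · exact ⟨ι, inferInstance, inferInstance, u, c, fun i => (h1 i).2, h2, h3⟩
  exfalso
  obtain ⟨ε, hε, hlim, hdet⟩ := det_seq M hM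
  obtain ⟨-, hBK, hmax⟩ := hJ
  have hbad : ∀ k, ∃ x ∈ closedBall (0 : EuclideanSpace ℝ (Fin n)) 1,
      x + ε k • (M.toEuclideanLin x + b) ∉ K := by
    intro k
    by_contra hcon
    push Not at hcon
    obtain ⟨f, hf, hvol⟩ := aff_exists (1 + ε k • M) (ε k • b) (by linarith [hdet k])
    have h1 := hmax (f '' closedBall 0 1) ⟨f, rfl⟩ (by
      rintro _ ⟨x, hx, rfl⟩
      rw [hf, one_add_smul_toLin, add_assoc, ← smul_add]
      exact hcon x hx)
    rw [hvol] at h1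
    have h2 : (1 : ℝ≥0∞) < ENNReal.ofReal |(1 + ε k • M).det| := by
      rw [← ENNReal.ofReal_one]
      exact (ENNReal.ofReal_lt_ofReal_iff (by linarith [hdet k, le_abs_self (1 + ε k • M).det])).2
        ((hdet k).trans_le (le_abs_self _))
    have h3 := ENNReal.mul_lt_mul_left (volB_pos (n := n)).ne' volB_lt h2
    rw [one_mul] at h3
    exact absurd h1 (not_le.2 h3)
  choose x hx hxK using hbad
  have hsep : ∀ k, ∃ v ∈ sphere (0 : EuclideanSpace ℝ (Fin n)) 1, ∀ y ∈ K,
      ⟪v, y⟫ ≤ ⟪v, x k + ε k • (M.toEuclideanLin (x k) + b)⟫ := fun k => by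
    obtain ⟨v, hv, s, hs, hy⟩ := sep_unit hKconv hKcomp.isClosed
      ⟨0, hBK (by simp)⟩ (hxK k)
    refine ⟨v, by simpa using hv, fun y hyK => ?_⟩
    rw [real_inner_comm, real_inner_comm _ v]
    exact ((hy y hyK).trans hs).le
  choose v hv hvK using hsep
  obtain ⟨⟨x₀, v₀⟩, hmem, φ, hφ, hφlim⟩ := ((isCompact_closedBall (0 : EuclideanSpace ℝ (Fin n)) 1).prod
    (isCompact_sphere (0 : EuclideanSpace ℝ (Fin n)) 1)).tendsto_subseq
    (x := fun k => (x k, v k)) (fun k => ⟨hx k, hv k⟩)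
  have hεφ : Filter.Tendsto (ε ∘ φ) Filter.atTop (nhds 0) := hlim.comp hφ.tendsto_atTop
  have hxl : Filter.Tendsto (x ∘ φ) Filter.atTop (nhds x₀) :=
    (continuous_fst.tendsto _).comp hφlim
  have hvl : Filter.Tendsto (v ∘ φ) Filter.atTop (nhds v₀) :=
    (continuous_snd.tendsto _).comp hφlim
  have hMc : Continuous fun x => M.toEuclideanLin x := LinearMap.continuous_of_finiteDimensional _
  have hMl : Filter.Tendsto (fun k => M.toEuclideanLin (x (φ k)) + b) Filter.atTop
      (nhds (M.toEuclideanLin x₀ + b)) := ((hMc.tendsto _).comp hxl).add_const b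
  have hlimR : Filter.Tendsto (fun k => ⟪v (φ k), x (φ k) + ε (φ k) • (M.toEuclideanLin (x (φ k)) + b)⟫)
      Filter.atTop (nhds ⟪v₀, x₀⟫) := by
    have := hvl.inner (hxl.add (hεφ.smul hMl)) (𝕜 := ℝ)
    simpa using this
  have hvn : ‖v₀‖ = 1 := by simpa using hmem.2
  have hxn : ‖x₀‖ ≤ 1 := by simpa using hmem.1
  have hlimy : ∀ y ∈ K, ⟪v₀, y⟫ ≤ ⟪v₀, x₀⟫ := fun y hy =>
    le_of_tendsto_of_tendsto (hvl.inner tendsto_const_nhds) hlimR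
      (Filter.Eventually.of_forall fun k => hvK (φ k) y hy)
  have hvx : ⟪v₀, x₀⟫ ≤ 1 := by
    have := real_inner_le_norm v₀ x₀
    rw [hvn, one_mul] at this
    exact this.trans hxn
  have hvB : ∀ v : EuclideanSpace ℝ (Fin n), ‖v‖ = 1 → v ∈ K := fun v hv => hBK (by simp [hv])
  have hge : 1 ≤ ⟪v₀, x₀⟫ := by
    have := hlimy v₀ (hvB _ hvn)
    rwa [real_inner_self_eq_norm_sq, hvn, one_pow] at this
  have hxv : x₀ = v₀ := by
    have h1 : ‖v₀ - x₀‖ ^ 2 ≤ 0 := by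
      rw [norm_sub_sq_real, hvn]
      nlinarith [norm_nonneg x₀]
    have h2 : ‖v₀ - x₀‖ = 0 := by nlinarith [norm_nonneg (v₀ - x₀)]
    exact (sub_eq_zero.1 (norm_eq_zero.1 h2)).symm
  have hpos : 0 ≤ ⟪v₀, M.toEuclideanLin x₀ + b⟫ := by
    refine ge_of_tendsto (hvl.inner hMl (𝕜 := ℝ)) (Filter.Eventually.of_forall fun k => ?_)
    have hvk : ‖v (φ k)‖ = 1 := by simpa using hv (φ k)
    have h1 := hvK (φ k) (v (φ k)) (hvB _ hvk)
    rw [real_inner_self_eq_norm_sq, hvk, inner_add_right, real_inner_smul_right] at h1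
    have h2 : ⟪v (φ k), x (φ k)⟫ ≤ 1 := by
      have := real_inner_le_norm (v (φ k)) (x (φ k))
      rw [hvk, one_mul] at this
      exact this.trans (by simpa using hx (φ k))
    have h3 : 0 ≤ ε (φ k) * ⟪v (φ k), M.toEuclideanLin (x (φ k)) + b⟫ := by linarith
    exact nonneg_of_mul_nonneg_right h3 (hε _)
  have hU0 : v₀ ∈ U := ⟨hmem.2, fun y hy => (hlimy y hy).trans hvx⟩
  have := hlt v₀ hU0
  rw [hxv, inner_add_right, real_inner_comm, real_inner_comm b] at hpos
  linarith

theorem loewner_decomp (hn : 1 ≤ n) {K : Set (EuclideanSpace ℝ (Fin n))} (hKcomp : IsCompact K)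
    (hL : IsLoewnerEllipsoid (closedBall 0 1) K) :
    ∃ (ι : Type) (_ : Fintype ι) (_ : Nonempty ι) (u : ι → EuclideanSpace ℝ (Fin n)) (c : ι → ℝ),
      (∀ i, u i ∈ K) ∧ IsDecomp u c ∧ ∑ i, c i • u i = 0 := by
  have hU : IsCompact (sphere 0 1 ∩ K) := (isCompact_sphere 0 1).inter hKcomp
  rcases decomp_or_sep hn hU (fun u hu => by simpa using hu.1) with
    ⟨ι, _, _, u, c, h1, h2, h3⟩ | ⟨M, b, hM, hlt⟩
  · exact ⟨ι, inferInstance, inferInstance, u, c, fun i => (h1 i).2, h2, h3⟩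
  exfalso
  obtain ⟨ε, hε, hlim, hdet⟩ := det_seq M hM
  obtain ⟨-, hKB, hmin⟩ := hL
  have hbad : ∀ k, ∃ x ∈ K, 1 < ‖x + ε k • (M.toEuclideanLin x + b)‖ := by
    intro k
    by_contra hcon
    push Not at hcon
    obtain ⟨f, hf, hvol⟩ := aff_exists (1 + ε k • M) (ε k • b) (by linarith [hdet k])
    have h1 := hmin (f.symm '' closedBall 0 1) ⟨f.symm, rfl⟩ (by
      intro x hx
      refine ⟨f x, ?_, by simp⟩
      rw [hf, one_add_smul_toLin, add_assoc, ← smul_add]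
      simpa using hcon x hx)
    have h0 := hvol (f.symm '' closedBall 0 1)
    rw [image_image] at h0
    simp only [AffineEquiv.apply_symm_apply, image_id'] at h0
    have h2 : (1 : ℝ≥0∞) < ENNReal.ofReal |(1 + ε k • M).det| := by
      rw [← ENNReal.ofReal_one]
      exact (ENNReal.ofReal_lt_ofReal_iff (by linarith [hdet k, le_abs_self (1 + ε k • M).det])).2
        ((hdet k).trans_le (le_abs_self _))
    have h3 := ENNReal.mul_lt_mul_left (volB_pos (n := n)).ne' volB_lt h2
    rw [one_mul] at h3
    have h4 : ENNReal.ofReal |(1 + ε k • M).det| * volume (closedBall (0 : EuclideanSpace ℝ (Fin n)) 1)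
        ≤ volume (closedBall (0 : EuclideanSpace ℝ (Fin n)) 1) := by
      conv_rhs => rw [h0]
      gcongr
    exact absurd h4 (not_le.2 h3)
  choose x hx hxK using hbad
  obtain ⟨x₀, hmem, φ, hφ, hxl⟩ := hKcomp.tendsto_subseq (x := x) hx
  have hεφ : Filter.Tendsto (ε ∘ φ) Filter.atTop (nhds 0) := hlim.comp hφ.tendsto_atTop
  have hMc : Continuous fun x => M.toEuclideanLin x := LinearMap.continuous_of_finiteDimensional _
  have hMl : Filter.Tendsto (fun k => M.toEuclideanLin (x (φ k)) + b) Filter.atTop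
      (nhds (M.toEuclideanLin x₀ + b)) := ((hMc.tendsto _).comp hxl).add_const b
  have hxn : ‖x₀‖ ≤ 1 := by simpa using hKB hmem
  have hn1 : ‖x₀‖ = 1 := by
    refine le_antisymm hxn ?_
    have h1 : Filter.Tendsto (fun k => ‖x (φ k) + ε (φ k) • (M.toEuclideanLin (x (φ k)) + b)‖)
        Filter.atTop (nhds ‖x₀‖) := by
      have := (hxl.add (hεφ.smul hMl)).norm
      simpa using this
    exact ge_of_tendsto h1 (Filter.Eventually.of_forall fun k => (hxK (φ k)).le)
  have hpos : 0 ≤ 2 * ⟪x₀, M.toEuclideanLin x₀ + b⟫ := by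
    have h1 : Filter.Tendsto (fun k => 2 * ⟪x (φ k), M.toEuclideanLin (x (φ k)) + b⟫
        + ε (φ k) * ‖M.toEuclideanLin (x (φ k)) + b‖ ^ 2) Filter.atTop
        (nhds (2 * ⟪x₀, M.toEuclideanLin x₀ + b⟫)) := by
      have := ((hxl.inner hMl (𝕜 := ℝ)).const_mul 2).add (hεφ.mul (hMl.norm.pow 2))
      simpa using this
    refine ge_of_tendsto h1 (Filter.Eventually.of_forall fun k => ?_)
    have hxk : ‖x (φ k)‖ ≤ 1 := by simpa using hKB (hx (φ k))
    have h2 : 1 < ‖x (φ k) + ε (φ k) • (M.toEuclideanLin (x (φ k)) + b)‖ ^ 2 := by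
      nlinarith [hxK (φ k)]
    rw [norm_add_sq_real, real_inner_smul_right, norm_smul, Real.norm_of_nonneg (hε _).le,
      mul_pow] at h2
    have h3 : ‖x (φ k)‖ ^ 2 ≤ 1 := by nlinarith [norm_nonneg (x (φ k))]
    have h4 : 0 ≤ ε (φ k) * (2 * ⟪x (φ k), M.toEuclideanLin (x (φ k)) + b⟫
        + ε (φ k) * ‖M.toEuclideanLin (x (φ k)) + b‖ ^ 2) := by nlinarith
    exact nonneg_of_mul_nonneg_right h4 (hε _)
  have := hlt x₀ ⟨by simpa using hn1, hmem⟩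
  rw [inner_add_right, real_inner_comm, real_inner_comm b] at hpos
  linarith

end JohnDecomp

/-! ### The ℓ-norm part -/

section EllPart
variable {n : ℕ}

lemma reg_sum_zero (hn : 1 ≤ n) {w : Fin (n + 1) → EuclideanSpace ℝ (Fin n)} (hw : IsRegVerts w) :
    ∑ i, w i = 0 := by
  have hnp : (0:ℝ) < n := by exact_mod_cast hn
  have h1 : ⟪∑ i, w i, ∑ i, w i⟫ = 0 := by
    rw [sum_inner]
    have h2 : ∀ i, ⟪w i, ∑ j, w j⟫ = 0 := fun i => by
      rw [inner_sum, ← Finset.add_sum_erase _ _ (Finset.mem_univ i),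
        Finset.sum_congr rfl fun j hj => hw.2 i j (Finset.ne_of_mem_erase hj).symm,
        real_inner_self_eq_norm_sq, hw.1 i]
      simp
      field_simp
      ring
    simp [h2]
  exact inner_self_eq_zero.1 h1

lemma reg_mx_nonneg (hn : 1 ≤ n) {w : Fin (n + 1) → EuclideanSpace ℝ (Fin n)} (hw : IsRegVerts w)
    (x : EuclideanSpace ℝ (Fin n)) : 0 ≤ mx w x := by
  have h1 : ∑ i, ⟪w i, x⟫ = 0 := by rw [← sum_inner, reg_sum_zero hn hw, inner_zero_left]
  have h2 : ∑ i, ⟪w i, x⟫ ≤ ∑ _i : Fin (n+1), mx w x := Finset.sum_le_sum fun i _ => le_mx w x i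
  rw [h1] at h2
  simp at h2
  have : (0:ℝ) < n + 1 := by positivity
  exact nonneg_of_mul_nonneg_right h2 this

lemma mx_smul {ι : Type*} [Fintype ι] [Nonempty ι] (u : ι → EuclideanSpace ℝ (Fin n)) {r : ℝ}
    (hr : 0 < r) (x : EuclideanSpace ℝ (Fin n)) : mx u (r • x) = r * mx u x := by
  refine eq_of_forall_ge_iff fun t => ?_
  rw [mx_le_iff, ← le_div_iff₀' hr, mx_le_iff]
  refine forall_congr' fun i => ?_
  rw [real_inner_smul_right, le_div_iff₀' hr]

lemma forall_convexHull_inner_le {s : Set (EuclideanSpace ℝ (Fin n))} {x : EuclideanSpace ℝ (Fin n)}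
    {t : ℝ} : (∀ y ∈ convexHull ℝ s, ⟪x, y⟫ ≤ t) ↔ ∀ y ∈ s, ⟪x, y⟫ ≤ t := by
  refine ⟨fun h y hy => h y (subset_convexHull ℝ s hy), fun h y hy => ?_⟩
  have hc : Convex ℝ {y | ⟪x, y⟫ ≤ t} := convex_halfSpace_le
    ⟨fun a b => inner_add_right _ _ _, fun a b => real_inner_smul_right _ _ _⟩ t
  exact convexHull_min (fun y hy => h y hy) hc hy

lemma polar_eq {m : ℕ} (w : Fin (m + 1) → EuclideanSpace ℝ (Fin n)) :
    polarSet (convexHull ℝ (range w)) = {x | mx w x ≤ 1} := by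
  ext x
  change (∀ y ∈ convexHull ℝ (range w), ⟪x, y⟫ ≤ 1) ↔ mx w x ≤ 1
  rw [forall_convexHull_inner_le, mx_le_iff]
  simp [real_inner_comm]

lemma gauge_polar (hn : 1 ≤ n) {w : Fin (n + 1) → EuclideanSpace ℝ (Fin n)} (hw : IsRegVerts w)
    (x : EuclideanSpace ℝ (Fin n)) : gauge (polarSet (convexHull ℝ (range w))) x = mx w x := by
  rw [polar_eq, gauge_def']
  have h : {r ∈ Ioi (0:ℝ) | r⁻¹ • x ∈ {x | mx w x ≤ 1}} = {r | 0 < r ∧ mx w x ≤ r} := by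
    ext r
    refine and_congr_right fun (hr : 0 < r) => ?_
    change mx w (r⁻¹ • x) ≤ 1 ↔ _
    rw [mx_smul _ (inv_pos.2 hr), inv_mul_le_iff₀ hr, mul_one]
  rw [h]
  rcases (reg_mx_nonneg hn hw x).eq_or_lt with h0 | h0
  · rw [← h0]
    have : {r : ℝ | 0 < r ∧ 0 ≤ r} = Ioi 0 := by
      ext r; exact ⟨fun h => h.1, fun h => ⟨h, le_of_lt h⟩⟩
    rw [this, csInf_Ioi]
  · have : {r : ℝ | 0 < r ∧ mx w x ≤ r} = Ici (mx w x) := by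
      ext r; exact ⟨fun h => h.2, fun h => ⟨h0.trans_le h, h⟩⟩
    rw [this, csInf_Ici]

lemma ell_polar (hn : 1 ≤ n) {w : Fin (n + 1) → EuclideanSpace ℝ (Fin n)} (hw : IsRegVerts w) :
    ellNorm n (polarSet (convexHull ℝ (range w))) = ∫ x, mx w x ∂(gaussianM n) := by
  rw [ellNorm]
  simp_rw [gauge_polar hn hw]

lemma cont_eq_of_integral_eq {f g : EuclideanSpace ℝ (Fin n) → ℝ} (hf : Continuous f)
    (hg : Continuous g) (hfi : Integrable f (gaussianM n)) (hgi : Integrable g (gaussianM n))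
    (hle : ∀ x, g x ≤ f x) (heq : ∫ x, f x ∂(gaussianM n) = ∫ x, g x ∂(gaussianM n)) : f = g := by
  have := gaussianM_openPos n
  have h := (integral_eq_iff_of_ae_le hgi hfi (Filter.Eventually.of_forall hle)).1 heq.symm
  exact ((hg.ae_eq_iff_eq (gaussianM n) hf).1 h).symm

theorem ell_part (hn : 1 ≤ n) {K : Set (EuclideanSpace ℝ (Fin n))}
    (hKcomp : IsCompact K) (hKconv : Convex ℝ K)
    {w : Fin (n + 1) → EuclideanSpace ℝ (Fin n)} (hw : IsRegVerts w)
    (hJ : IsJohnEllipsoid (closedBall (0 : EuclideanSpace ℝ (Fin n)) 1) K) :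
    ellNorm n (polarSet (convexHull ℝ (Set.range w))) ≤ ellNorm n K ∧
      (ellNorm n K = ellNorm n (polarSet (convexHull ℝ (Set.range w))) ↔
        ∃ v : Fin (n + 1) → EuclideanSpace ℝ (Fin n),
          IsRegVerts v ∧ K = polarSet (convexHull ℝ (Set.range v))) := by
  obtain ⟨ι, _, _, u, c, huK, hd, h0⟩ := john_decomp hn hKcomp hKconv hJ
  have hBK := hJ.2.1
  have hnhds : K ∈ nhds (0 : EuclideanSpace ℝ (Fin n)) :=
    Filter.mem_of_superset (closedBall_mem_nhds 0 one_pos) hBK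
  have habs : Absorbent ℝ K := absorbent_nhds_zero hnhds
  have hgc : Continuous (gauge K) := continuous_gauge hKconv hnhds
  have hge : ∀ x, mx u x ≤ gauge K x := fun x => by
    rw [gauge_def', mx_le_iff]
    intro i
    have hne := habs.gauge_set_nonempty (x := x)
    refine le_csInf ?_ ?_
    · obtain ⟨r, hr, hx⟩ := hne
      refine ⟨r, hr, ?_⟩
      rwa [mem_smul_set_iff_inv_smul_mem₀ (ne_of_gt hr)] at hx
    · rintro r ⟨hr, hx⟩
      have hr : 0 < r := hr
      have := huK i _ hx
      rwa [real_inner_smul_right, inv_mul_le_iff₀ hr, mul_one] at this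
  have hgle : ∀ x, gauge K x ≤ ‖x‖ := fun x => by
    have := gauge_mono (absorbent_nhds_zero (closedBall_mem_nhds (0 : EuclideanSpace ℝ (Fin n))
      one_pos)) hBK x
    rwa [gauge_closedBall zero_le_one, div_one] at this
  have hgi : Integrable (gauge K) (gaussianM n) :=
    (gaussianM_norm_integrable n).mono' hgc.aestronglyMeasurable
      (Filter.Eventually.of_forall fun x => by
        rw [Real.norm_of_nonneg (gauge_nonneg x)]; exact hgle x)
  have hmi := mx_integrable hd.1
  have hmain := main_compare hn hw hd h0
  have hle2 : ∫ x, mx u x ∂(gaussianM n) ≤ ellNorm n K := integral_mono hmi hgi hge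
  rw [ell_polar hn hw]
  refine ⟨hmain.1.trans hle2, fun heq => ?_, ?_⟩
  · have h1 : ∫ x, mx u x ∂(gaussianM n) = ∫ x, mx w x ∂(gaussianM n) :=
      le_antisymm (hle2.trans heq.le) hmain.1
    obtain ⟨v, hv, hvr⟩ := hmain.2 h1
    refine ⟨v, hv, ?_⟩
    have h2 : gauge K = mx u := cont_eq_of_integral_eq hgc (mx_cont u) hgi hmi hge
      (heq.trans h1.symm)
    rw [polar_eq, mx_congr_range hvr, ← h2]
    ext x
    change x ∈ K ↔ gauge K x ≤ 1
    rw [gauge_le_one_iff_mem_closure hKconv hnhds, hKcomp.isClosed.closure_eq]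
  · rintro ⟨v, hv, rfl⟩
    rw [ell_polar hn hv]
    exact reg_integral_eq hn hv hw

end EllPart

/-! ### Hausdorff measure of the sphere -/

section SphereMeasure

lemma sphere_hausdorff_pos (m : ℕ) :
    0 < μH[(m : ℝ)] (sphere (0 : EuclideanSpace ℝ (Fin (m + 1))) 1) := by
  let f : EuclideanSpace ℝ (Fin (m + 1)) → (Fin m → ℝ) := fun x j => x j.succ
  have hf : LipschitzWith 1 f := by
    refine LipschitzWith.of_dist_le_mul fun x y => ?_
    rw [NNReal.coe_one, one_mul, dist_pi_le_iff dist_nonneg]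
    intro j
    rw [dist_eq_norm, dist_eq_norm]
    exact PiLp.norm_apply_le (x - y) j.succ
  have hsub : ball (0 : Fin m → ℝ) (1 / (m + 1)) ⊆ f '' sphere 0 1 := by
    intro y hy
    rw [mem_ball_zero_iff] at hy
    have hy1 : ∀ j, y j ^ 2 ≤ 1 / (m + 1) := fun j => by
      have h1 : |y j| ≤ 1 / (m + 1) := (norm_le_pi_norm y j).trans hy.le
      have h2 : (1 : ℝ) / (m + 1) ≤ 1 := by
        rw [div_le_one (by positivity)]; linarith [(Nat.cast_nonneg m : (0:ℝ) ≤ m)]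
      rw [← sq_abs]
      nlinarith [abs_nonneg (y j)]
    have hsum : ∑ j, y j ^ 2 ≤ 1 := by
      calc ∑ j, y j ^ 2 ≤ ∑ _j : Fin m, (1 : ℝ) / (m + 1) := Finset.sum_le_sum fun j _ => hy1 j
        _ = m / (m + 1) := by simp [div_eq_mul_inv]
        _ ≤ 1 := by rw [div_le_one (by positivity)]; linarith
    refine ⟨WithLp.toLp 2 (Fin.cons (√(1 - ∑ j, y j ^ 2)) y), ?_, ?_⟩
    · rw [mem_sphere_zero_iff_norm, EuclideanSpace.norm_eq, Fin.sum_univ_succ]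
      simp [Real.sq_sqrt (sub_nonneg.2 hsum), abs_of_nonneg (Real.sqrt_nonneg _)]
    · ext j; simp [f]
  have h1 := hf.hausdorffMeasure_image_le (Nat.cast_nonneg m : (0:ℝ) ≤ m) (sphere 0 1)
  have h2 : 0 < (μH[(m:ℝ)] : Measure (Fin m → ℝ)) (ball 0 (1 / (m + 1))) := by
    have h3 := hausdorffMeasure_pi_real (ι := Fin m)
    rw [Fintype.card_fin] at h3
    rw [h3]
    exact measure_ball_pos _ _ (by positivity)
  have h4 := (h2.trans_le (measure_mono hsub)).trans_le h1
  simpa using h4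

lemma normalize_dist {V : Type*} [NormedAddCommGroup V] [NormedSpace ℝ V] {a b : V} (ha : 1 ≤ ‖a‖)
    (hb : 1 ≤ ‖b‖) : ‖‖a‖⁻¹ • a - ‖b‖⁻¹ • b‖ ≤ 2 * ‖a - b‖ := by
  have ha0 : 0 < ‖a‖ := by linarith
  have hb0 : 0 < ‖b‖ := by linarith
  have h1 : ‖a‖⁻¹ • a - ‖b‖⁻¹ • b = ‖a‖⁻¹ • (a - b) + (‖a‖⁻¹ - ‖b‖⁻¹) • b := by module
  have h2 : ‖‖a‖⁻¹ • (a - b)‖ ≤ ‖a - b‖ := by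
    rw [norm_smul, norm_inv, norm_norm]
    exact mul_le_of_le_one_left (norm_nonneg _) (inv_le_one_of_one_le₀ ha)
  have h3 : ‖(‖a‖⁻¹ - ‖b‖⁻¹) • b‖ ≤ ‖a - b‖ := by
    have : ‖a‖⁻¹ - ‖b‖⁻¹ = ‖a‖⁻¹ * ‖b‖⁻¹ * (‖b‖ - ‖a‖) := by field_simp
    rw [norm_smul, this, norm_mul, norm_mul, norm_inv, norm_inv, norm_norm, norm_norm,
      Real.norm_eq_abs]
    have h4 : |‖b‖ - ‖a‖| ≤ ‖a - b‖ := by rw [norm_sub_rev]; exact abs_norm_sub_norm_le b a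
    have h5 : ‖a‖⁻¹ * ‖b‖⁻¹ * |‖b‖ - ‖a‖| * ‖b‖ = ‖a‖⁻¹ * |‖b‖ - ‖a‖| := by field_simp
    rw [h5]
    exact (mul_le_of_le_one_left (abs_nonneg _) (inv_le_one_of_one_le₀ ha)).trans h4
  rw [h1]
  linarith [norm_add_le (‖a‖⁻¹ • (a - b)) ((‖a‖⁻¹ - ‖b‖⁻¹) • b)]

lemma sphere_hausdorff_lt_top (m : ℕ) :
    μH[(m : ℝ)] (sphere (0 : EuclideanSpace ℝ (Fin (m + 1))) 1) < ⊤ := by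
  let J : Fin (m + 1) → Bool → (Fin m → ℝ) → EuclideanSpace ℝ (Fin (m + 1)) := fun i s y =>
    WithLp.toLp 2 (i.insertNth (if s then (1:ℝ) else -1) y)
  let G : Fin (m + 1) → Bool → (Fin m → ℝ) → EuclideanSpace ℝ (Fin (m + 1)) := fun i s y =>
    ‖J i s y‖⁻¹ • J i s y
  have hJ1 : ∀ i s y, 1 ≤ ‖J i s y‖ := fun i s y => by
    have h := PiLp.norm_apply_le (J i s y) i
    have h2 : ‖(J i s y) i‖ = 1 := by
      cases s <;> simp [J]
    rwa [h2] at h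
  obtain ⟨C, hC⟩ : ∃ C, LipschitzWith C (WithLp.toLp 2 : (Fin (m+1) → ℝ) → _) :=
    ⟨_, PiLp.lipschitzWith_toLp 2 _⟩
  have hJL : ∀ i s y z, dist (J i s y) (J i s z) ≤ C * dist y z := fun i s y z => by
    refine (hC.dist_le_mul _ _).trans (mul_le_mul_of_nonneg_left ?_ C.2)
    rw [dist_pi_le_iff dist_nonneg, Fin.forall_iff_succAbove i]
    refine ⟨by simp, fun j => ?_⟩
    simp only [Fin.insertNth_apply_succAbove]
    exact dist_le_pi_dist y z j
  have hGL : ∀ i s, LipschitzWith (2 * C) (G i s) := fun i s => by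
    refine LipschitzWith.of_dist_le_mul fun y z => ?_
    have h1 := normalize_dist (hJ1 i s y) (hJ1 i s z)
    have h2 := hJL i s y z
    rw [dist_eq_norm] at h2 ⊢
    push_cast
    linarith
  have hcov : sphere (0 : EuclideanSpace ℝ (Fin (m + 1))) 1 ⊆
      ⋃ p : Fin (m + 1) × Bool, G p.1 p.2 '' closedBall 0 1 := by
    intro x hx
    rw [mem_sphere_zero_iff_norm] at hx
    obtain ⟨i, -, hi⟩ := Finset.exists_max_image Finset.univ (fun i => |x i|) Finset.univ_nonempty
    have hxi : 0 < |x i| := by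
      by_contra hcon
      have h0 : x = 0 := by
        ext j
        have := hi j (Finset.mem_univ j)
        exact abs_eq_zero.1 (le_antisymm (this.trans (not_lt.1 hcon)) (abs_nonneg _))
      rw [h0, norm_zero] at hx
      norm_num at hx
    refine mem_iUnion.2 ⟨(i, decide (0 < x i)), fun j => |x i|⁻¹ * x (i.succAbove j), ?_, ?_⟩
    · rw [mem_closedBall_zero_iff, pi_norm_le_iff_of_nonneg zero_le_one]
      intro j
      rw [norm_mul, norm_inv, Real.norm_eq_abs, Real.norm_eq_abs, abs_abs, inv_mul_le_iff₀ hxi,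
        mul_one]
      exact hi _ (Finset.mem_univ _)
    · have hJx : J i (decide (0 < x i)) (fun j => |x i|⁻¹ * x (i.succAbove j)) = |x i|⁻¹ • x := by
        ext j
        revert j
        rw [Fin.forall_iff_succAbove i]
        refine ⟨?_, fun j => by simp [J]⟩
        by_cases h : 0 < x i
        · simp [J, h, abs_of_pos h, h.ne']
        · have h' : x i < 0 := lt_of_le_of_ne (not_lt.1 h) (abs_pos.1 hxi)
          simp [J, h, abs_of_neg h', h'.ne]
      simp only [G, hJx, norm_smul, hx, norm_inv, Real.norm_eq_abs, abs_abs, mul_one, inv_inv,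
        smul_smul]
      rw [mul_inv_cancel₀ hxi.ne', one_smul]
  refine (measure_mono hcov).trans_lt ?_
  refine (measure_iUnion_le _).trans_lt ?_
  rw [tsum_fintype]
  refine ENNReal.sum_lt_top.2 fun p _ => ?_
  refine ((hGL p.1 p.2).hausdorffMeasure_image_le (Nat.cast_nonneg m) _).trans_lt ?_
  have h3 := hausdorffMeasure_pi_real (ι := Fin m)
  rw [Fintype.card_fin] at h3
  rw [h3]
  exact ENNReal.mul_lt_top (ENNReal.rpow_lt_top_of_nonneg (Nat.cast_nonneg m) ENNReal.coe_ne_top)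
    measure_closedBall_lt_top

end SphereMeasure

/-! ### Uniqueness of rotation invariant measures on the sphere -/

section Uniq
variable {n : ℕ}

lemma rot_ball {μ : Measure (EuclideanSpace ℝ (Fin n))}
    (hinv : ∀ g : EuclideanSpace ℝ (Fin n) ≃ₗᵢ[ℝ] EuclideanSpace ℝ (Fin n), μ.map g = μ)
    {x y : EuclideanSpace ℝ (Fin n)} (hx : ‖x‖ = 1) (hy : ‖y‖ = 1) (ε : ℝ) :
    μ.real (ball x ε) = μ.real (ball y ε) := by
  let g := Submodule.reflection (ℝ ∙ (x - y))ᗮ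
  have hg : g x = y := Submodule.reflection_sub (hx.trans hy.symm)
  have h1 : μ.map g (ball y ε) = μ (ball y ε) := by rw [hinv g]
  rw [Measure.map_apply g.continuous.measurable measurableSet_ball] at h1
  have h2 : g ⁻¹' (ball y ε) = ball x ε := by
    rw [← hg]; ext z; simp
  rw [h2] at h1
  rw [Measure.real, Measure.real, h1]

lemma inv_ball_pos {μ : Measure (EuclideanSpace ℝ (Fin n))} [IsFiniteMeasure μ]
    (hinv : ∀ g : EuclideanSpace ℝ (Fin n) ≃ₗᵢ[ℝ] EuclideanSpace ℝ (Fin n), μ.map g = μ)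
    (hS : μ (sphere 0 1)ᶜ = 0) (hpos : 0 < μ.real univ)
    {x : EuclideanSpace ℝ (Fin n)} (hx : ‖x‖ = 1) {ε : ℝ} (hε : 0 < ε) :
    0 < μ.real (ball x ε) := by
  by_contra hcon
  have hz : ∀ y ∈ sphere (0 : EuclideanSpace ℝ (Fin n)) 1, μ (ball y ε) = 0 := fun y hy => by
    rw [mem_sphere_zero_iff_norm] at hy
    have h1 : μ.real (ball y ε) = 0 := by
      rw [← rot_ball hinv hx hy ε]
      exact le_antisymm (not_lt.1 hcon) measureReal_nonneg
    rwa [measureReal_eq_zero_iff] at h1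
  have h0 : μ (sphere 0 1) = 0 := by
    obtain ⟨t, ht, hcov⟩ := (isCompact_sphere (0 : EuclideanSpace ℝ (Fin n)) 1).elim_nhds_subcover
      (fun y => ball y ε) (fun y _ => ball_mem_nhds y hε)
    refine measure_mono_null hcov ?_
    exact (measure_biUnion_null_iff t.countable_toSet).2 fun y hy => hz y (ht y hy)
  have h1 : μ univ = 0 := by
    rw [← union_compl_self (sphere (0 : EuclideanSpace ℝ (Fin n)) 1)]
    exact measure_union_null h0 hS
  rw [Measure.real, h1] at hpos
  simp at hpos

/-- Fubini for the `ε`-neighbourhood of the diagonal. -/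
lemma diag_fubini {μ ν : Measure (EuclideanSpace ℝ (Fin n))} [IsFiniteMeasure μ] [IsFiniteMeasure ν]
    (hμS : μ (sphere 0 1)ᶜ = 0) {ε b : ℝ} (hb : ∀ x, ‖x‖ = 1 → ν.real (ball x ε) = b)
    {f : EuclideanSpace ℝ (Fin n) → ℝ} (hf : Continuous f) {C : ℝ} (hC : ∀ x, |f x| ≤ C) :
    Integrable (fun p : EuclideanSpace ℝ (Fin n) × EuclideanSpace ℝ (Fin n) =>
      {p | dist p.1 p.2 < ε}.indicator (fun p => f p.1) p) (μ.prod ν) ∧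
    ∫ p, {p : EuclideanSpace ℝ (Fin n) × EuclideanSpace ℝ (Fin n) | dist p.1 p.2 < ε}.indicator
      (fun p => f p.1) p ∂(μ.prod ν) = b * ∫ x, f x ∂μ := by
  have hD : MeasurableSet {p : EuclideanSpace ℝ (Fin n) × EuclideanSpace ℝ (Fin n) |
      dist p.1 p.2 < ε} := (isOpen_lt (by fun_prop) continuous_const).measurableSet
  have hintg : Integrable (fun p : EuclideanSpace ℝ (Fin n) × EuclideanSpace ℝ (Fin n) =>
      {p | dist p.1 p.2 < ε}.indicator (fun p => f p.1) p) (μ.prod ν) := by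
    have h1 : Integrable (fun p : EuclideanSpace ℝ (Fin n) × EuclideanSpace ℝ (Fin n) => f p.1)
        (μ.prod ν) := by
      refine Integrable.of_bound (by fun_prop) C (Filter.Eventually.of_forall fun p => hC p.1)
    exact h1.indicator hD
  refine ⟨hintg, ?_⟩
  rw [integral_prod _ hintg, ← integral_const_mul]
  have hae : ∀ᵐ x ∂μ, x ∈ sphere (0 : EuclideanSpace ℝ (Fin n)) 1 := hμS
  refine integral_congr_ae ?_
  filter_upwards [hae] with x hx
  rw [mem_sphere_zero_iff_norm] at hx
  have h2 : (fun y => {p : EuclideanSpace ℝ (Fin n) × EuclideanSpace ℝ (Fin n) |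
      dist p.1 p.2 < ε}.indicator (fun p => f p.1) (x, y)) =
      (ball x ε).indicator fun _ => f x := by
    ext y
    by_cases h : dist x y < ε
    · rw [indicator_of_mem (by exact h), indicator_of_mem (by rw [mem_ball']; exact h)]
    · rw [indicator_of_notMem (by exact h), indicator_of_notMem (by rw [mem_ball']; exact h)]
  rw [h2, integral_indicator measurableSet_ball, setIntegral_const, hb x hx, smul_eq_mul]

lemma uniq_measure {μ ν : Measure (EuclideanSpace ℝ (Fin n))} [IsFiniteMeasure μ] [IsFiniteMeasure ν]
    (hμ : ∀ g : EuclideanSpace ℝ (Fin n) ≃ₗᵢ[ℝ] EuclideanSpace ℝ (Fin n), μ.map g = μ)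
    (hν : ∀ g : EuclideanSpace ℝ (Fin n) ≃ₗᵢ[ℝ] EuclideanSpace ℝ (Fin n), ν.map g = ν)
    (hμS : μ (sphere 0 1)ᶜ = 0) (hνS : ν (sphere 0 1)ᶜ = 0)
    (hμ0 : 0 < μ.real univ) (hν0 : 0 < ν.real univ)
    {f : EuclideanSpace ℝ (Fin n) → ℝ} {L : NNReal} (hf : LipschitzWith L f)
    {C : ℝ} (hC : ∀ x, |f x| ≤ C) :
    ν.real univ * ∫ x, f x ∂μ = μ.real univ * ∫ x, f x ∂ν := by
  obtain ⟨x₀, hx₀⟩ : ∃ x : EuclideanSpace ℝ (Fin n), ‖x‖ = 1 := by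
    by_contra hcon
    push Not at hcon
    have : (sphere (0 : EuclideanSpace ℝ (Fin n)) 1)ᶜ = univ := by
      ext x; simpa using hcon x
    rw [this] at hμS
    rw [Measure.real, hμS] at hμ0
    simp at hμ0
  set M := μ.real univ
  set N := ν.real univ
  set I := ∫ x, f x ∂μ
  set J := ∫ x, f x ∂ν
  have key : ∀ ε : ℝ, 0 < ε → |N * I - M * J| ≤ L * M * N * ε := by
    intro ε hε
    set D := {p : EuclideanSpace ℝ (Fin n) × EuclideanSpace ℝ (Fin n) | dist p.1 p.2 < ε} with hDdef
    have hD : MeasurableSet D := (isOpen_lt (by fun_prop) continuous_const).measurableSet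
    set a := μ.real (ball x₀ ε)
    set b := ν.real (ball x₀ ε)
    have hb0 : 0 < b := inv_ball_pos hν hνS hν0 hx₀ hε
    have ha : ∀ x, ‖x‖ = 1 → μ.real (ball x ε) = a := fun x hx => rot_ball hμ hx hx₀ ε
    have hb : ∀ x, ‖x‖ = 1 → ν.real (ball x ε) = b := fun x hx => rot_ball hν hx hx₀ ε
    have hswap : ∀ F : EuclideanSpace ℝ (Fin n) → ℝ,
        ((fun p => D.indicator (fun p => F p.1) p) ∘ Prod.swap) =
          fun p => D.indicator (fun p => F p.2) p := fun F => by
      ext p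
      by_cases h : dist p.1 p.2 < ε
      · simp only [Function.comp]
        rw [indicator_of_mem (by change dist p.2 p.1 < ε; rwa [dist_comm]),
          indicator_of_mem (by exact h)]
        rfl
      · simp only [Function.comp]
        rw [indicator_of_notMem (by change ¬ dist p.2 p.1 < ε; rwa [dist_comm]),
          indicator_of_notMem (by exact h)]
    obtain ⟨i1, e1⟩ := diag_fubini (μ := μ) (ν := ν) hμS hb hf.continuous hC
    obtain ⟨i2, e2⟩ := diag_fubini (μ := ν) (ν := μ) hνS ha hf.continuous hC
    obtain ⟨-, e3⟩ := diag_fubini (μ := μ) (ν := ν) (f := fun _ => 1) (C := 1) hμS hb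
      continuous_const (by simp)
    obtain ⟨-, e4⟩ := diag_fubini (μ := ν) (ν := μ) (f := fun _ => 1) (C := 1) hνS ha
      continuous_const (by simp)
    rw [← hDdef] at e1 e2 e3 e4 i1 i2
    rw [← integral_prod_swap] at e2 e4
    have i2' := i2.swap
    rw [hswap f] at i2'
    have e2' : ∫ p, D.indicator (fun p => f p.2) p ∂(μ.prod ν) = a * J := by
      rw [← e2]; rw [← hswap f]; rfl
    have e4' : ∫ p, D.indicator (fun _ => (1:ℝ)) p ∂(μ.prod ν) = a * N := by
      have h5 : a * ∫ _x : EuclideanSpace ℝ (Fin n), (1:ℝ) ∂ν = a * N := by simp [N]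
      rw [← h5, ← e4, ← hswap (fun _ => 1)]; rfl
    have e3' : ∫ p, D.indicator (fun _ => (1:ℝ)) p ∂(μ.prod ν) = b * M := by
      rw [e3]; simp [M]
    have hab : b * M = a * N := by rw [← e3', e4']
    have hdiff : |b * I - a * J| ≤ L * ε * (b * M) := by
      rw [← e1, ← e2', ← integral_sub i1 i2', ← e3', ← integral_const_mul, ← Real.norm_eq_abs]
      refine norm_integral_le_of_norm_le ?_ (Filter.Eventually.of_forall fun p => ?_)
      · exact ((integrable_const (1:ℝ)).indicator hD).const_mul _
      · by_cases h : p ∈ D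
        · simp only [indicator_of_mem h]
          rw [← dist_eq_norm, mul_one]
          refine (hf.dist_le_mul _ _).trans (mul_le_mul_of_nonneg_left (le_of_lt h) L.2)
        · simp only [indicator_of_notMem h]
          simp
    have h1 : b * (N * I - M * J) = N * (b * I - a * J) := by linear_combination -J * hab
    have h2 : b * |N * I - M * J| ≤ b * (L * M * N * ε) := by
      rw [← abs_of_pos hb0, ← abs_mul, abs_of_pos hb0, h1, abs_mul, abs_of_pos hν0]
      calc N * |b * I - a * J| ≤ N * (L * ε * (b * M)) := mul_le_mul_of_nonneg_left hdiff hν0.le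
        _ = b * (L * M * N * ε) := by ring
    exact le_of_mul_le_mul_left h2 hb0
  have h0 : |N * I - M * J| ≤ 0 := by
    refine ge_of_tendsto (x := nhdsWithin 0 (Ioi 0)) (f := fun ε : ℝ => L * M * N * ε) ?_
      (Filter.eventually_of_mem self_mem_nhdsWithin key)
    have : Continuous fun ε : ℝ => L * M * N * ε := by fun_prop
    have h := this.tendsto 0
    rw [mul_zero] at h
    exact h.mono_left nhdsWithin_le_nhds
  exact sub_eq_zero.1 (abs_eq_zero.1 (le_antisymm h0 (abs_nonneg _)))

end Uniq

/-! ### Gaussian representation of spherical integrals -/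

section GaussSphere
variable {n : ℕ}

/-- Radial projection. -/
def rproj (x : EuclideanSpace ℝ (Fin n)) : EuclideanSpace ℝ (Fin n) := ‖x‖⁻¹ • x

lemma rproj_meas : Measurable (rproj : EuclideanSpace ℝ (Fin n) → _) := by
  unfold rproj
  fun_prop

/-- The spherical measure induced by the Gaussian measure. -/
def gsph (n : ℕ) : Measure (EuclideanSpace ℝ (Fin n)) :=
  ((gaussianM n).withDensity fun x => ((‖x‖₊ : NNReal) : ℝ≥0∞)).map rproj

lemma gsph_finite (n : ℕ) : IsFiniteMeasure (gsph n) := by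
  have h : IsFiniteMeasure ((gaussianM n).withDensity fun x => ((‖x‖₊ : NNReal) : ℝ≥0∞)) := by
    refine isFiniteMeasure_withDensity ?_
    have h2 := (gaussianM_norm_integrable n).2
    rw [hasFiniteIntegral_iff_enorm] at h2
    simpa [enorm] using h2.ne
  unfold gsph
  infer_instance

lemma gsph_integral {f h : EuclideanSpace ℝ (Fin n) → ℝ} (hf : Continuous f)
    (hh : ∀ (r : ℝ) x, 0 ≤ r → h (r • x) = r * h x) (hfh : ∀ x, ‖x‖ = 1 → f x = h x) :
    ∫ x, f x ∂(gsph n) = ∫ x, h x ∂(gaussianM n) := by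
  rw [gsph, integral_map rproj_meas.aemeasurable hf.aestronglyMeasurable,
    integral_withDensity_eq_integral_smul (by fun_prop)]
  refine integral_congr_ae (Filter.Eventually.of_forall fun x => ?_)
  simp only [rproj]
  by_cases hx : x = 0
  · have := hh 0 0 le_rfl
    simp only [zero_smul, zero_mul] at this
    simp [hx, this]
  · have hx' : ‖x‖ ≠ 0 := norm_ne_zero_iff.2 hx
    rw [hfh _ (by simp [norm_smul, hx]), hh _ _ (by positivity), NNReal.smul_def, coe_nnnorm,
      smul_eq_mul, ← mul_assoc, mul_inv_cancel₀ hx', one_mul]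

lemma gsph_map (g : EuclideanSpace ℝ (Fin n) ≃ₗᵢ[ℝ] EuclideanSpace ℝ (Fin n)) :
    (gsph n).map g = gsph n := by
  ext s hs
  have hgm := g.continuous.measurable
  rw [Measure.map_apply hgm hs, gsph, Measure.map_apply rproj_meas (hgm hs),
    Measure.map_apply rproj_meas hs, withDensity_apply _ (rproj_meas (hgm hs)),
    withDensity_apply _ (rproj_meas hs)]
  conv_rhs => rw [← gaussianM_map n g]
  rw [setLIntegral_map (rproj_meas hs) (by fun_prop) hgm]
  have : rproj ⁻¹' (g ⁻¹' s) = g ⁻¹' (rproj ⁻¹' s) := by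
    ext x
    simp [rproj]
  rw [this]
  simp

lemma gsph_compl (n : ℕ) : gsph n (sphere 0 1)ᶜ = 0 := by
  have hm : MeasurableSet (sphere (0 : EuclideanSpace ℝ (Fin n)) 1)ᶜ :=
    isClosed_sphere.measurableSet.compl
  rw [gsph, Measure.map_apply rproj_meas hm, withDensity_apply _ (rproj_meas hm)]
  have h0 : rproj ⁻¹' (sphere (0 : EuclideanSpace ℝ (Fin n)) 1)ᶜ ⊆ {0} := by
    intro x hx
    by_contra hx0
    have hx0 : x ≠ 0 := hx0
    exact hx (by simp [rproj, norm_smul, hx0])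
  rw [setLIntegral_eq_zero_iff (rproj_meas hm) (by fun_prop)]
  refine Filter.Eventually.of_forall fun x hx => ?_
  have : x = 0 := h0 hx
  simp [this]

lemma gsph_pos (hn : 1 ≤ n) : 0 < (gsph n).real univ := by
  have := gsph_finite n
  have := gaussianM_openPos n
  refine ENNReal.toReal_pos ?_ (measure_ne_top _ _)
  intro h0
  rw [gsph, Measure.map_apply rproj_meas MeasurableSet.univ, preimage_univ,
    withDensity_apply _ MeasurableSet.univ, Measure.restrict_univ,
    lintegral_eq_zero_iff (by fun_prop)] at h0
  have h1 : (fun x : EuclideanSpace ℝ (Fin n) => ‖x‖) =ᵐ[gaussianM n] fun _ => 0 := by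
    filter_upwards [h0] with x hx
    simpa using hx
  have h2 := (continuous_norm.ae_eq_iff_eq (gaussianM n) continuous_const).1 h1
  have h3 := congrFun h2 (EuclideanSpace.single ⟨0, hn⟩ 1)
  simp at h3

lemma sph_map (g : EuclideanSpace ℝ (Fin n) ≃ₗᵢ[ℝ] EuclideanSpace ℝ (Fin n)) (d : ℝ) :
    ((μH[d] : Measure (EuclideanSpace ℝ (Fin n))).restrict (sphere 0 1)).map g =
      (μH[d] : Measure (EuclideanSpace ℝ (Fin n))).restrict (sphere 0 1) := by
  have h1 := (g.toIsometryEquiv.measurePreserving_hausdorffMeasure d).restrict_preimage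
    (isClosed_sphere (x := (0 : EuclideanSpace ℝ (Fin n))) (ε := 1)).measurableSet
  have h2 : g.toIsometryEquiv ⁻¹' (sphere 0 1) = sphere (0 : EuclideanSpace ℝ (Fin n)) 1 := by
    ext x; simp
  rw [h2] at h1
  exact h1.map_eq

lemma lip_trunc {f : EuclideanSpace ℝ (Fin n) → ℝ} {L : NNReal} (hf : LipschitzWith L f) (c : ℝ) :
    LipschitzWith L (fun x => max (-c) (min c (f x))) :=
  (hf.const_min c).const_max (-c)

theorem sphere_gauss (hn : 1 ≤ n) : ∃ C : ℝ, 0 < C ∧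
    ∀ (h : EuclideanSpace ℝ (Fin n) → ℝ) (L : NNReal), LipschitzWith L h →
      (∀ (r : ℝ) x, 0 ≤ r → h (r • x) = r * h x) →
      ∫ x in sphere (0 : EuclideanSpace ℝ (Fin n)) 1, h x ∂(μH[(n : ℝ) - 1]) =
        C * ∫ x, h x ∂(gaussianM n) := by
  obtain ⟨m, rfl⟩ : ∃ m, n = m + 1 := ⟨n - 1, by omega⟩
  have hd : ((m + 1 : ℕ) : ℝ) - 1 = m := by push_cast; ring
  rw [hd]
  set μ := (μH[(m : ℝ)] : Measure (EuclideanSpace ℝ (Fin (m + 1)))).restrict (sphere 0 1) with hμ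
  have hmS := (isClosed_sphere (x := (0 : EuclideanSpace ℝ (Fin (m+1)))) (ε := 1)).measurableSet
  have hμu : μ univ = μH[(m : ℝ)] (sphere (0 : EuclideanSpace ℝ (Fin (m + 1))) 1) := by
    rw [hμ, Measure.restrict_apply_univ]
  have hfin : IsFiniteMeasure μ := ⟨by rw [hμu]; exact sphere_hausdorff_lt_top m⟩
  have hpos : 0 < μ.real univ :=
    ENNReal.toReal_pos (by rw [hμu]; exact (sphere_hausdorff_pos m).ne') (measure_ne_top _ _)
  have hμS : μ (sphere 0 1)ᶜ = 0 := by
    rw [hμ, Measure.restrict_apply hmS.compl]; simp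
  have := gsph_finite (m + 1)
  have hN := gsph_pos (n := m + 1) hn
  refine ⟨μ.real univ / (gsph (m + 1)).real univ, div_pos hpos hN, fun h L hL hh => ?_⟩
  set f : EuclideanSpace ℝ (Fin (m + 1)) → ℝ := fun x => max (-(L:ℝ)) (min L (h x)) with hf
  have hfL : LipschitzWith L f := lip_trunc hL L
  have hfh : ∀ x, ‖x‖ = 1 → f x = h x := fun x hx => by
    have h0 : h 0 = 0 := by simpa using hh 0 0 le_rfl
    have h1 := hL.dist_le_mul x 0
    rw [h0, dist_zero_right, dist_zero_right, hx, mul_one, Real.norm_eq_abs, abs_le] at h1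
    rw [hf]
    simp only
    rw [min_eq_right h1.2, max_eq_right h1.1]
  have hC : ∀ x, |f x| ≤ L := fun x => by
    rw [abs_le]
    refine ⟨le_max_left _ _, max_le ?_ (min_le_left _ _)⟩
    linarith [L.2, show (0:ℝ) ≤ L from L.2]
  have key := uniq_measure (μ := μ) (ν := gsph (m + 1)) (fun g => sph_map g _) gsph_map hμS
    (gsph_compl _) hpos hN hfL hC
  rw [gsph_integral hfL.continuous hh hfh] at key
  have e1 : ∫ x, h x ∂μ = ∫ x, f x ∂μ :=
    setIntegral_congr_fun hmS fun x hx => (hfh x (by simpa using hx)).symm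
  rw [e1, div_mul_eq_mul_div, eq_div_iff hN.ne', ← key, mul_comm]

end GaussSphere

/-! ### The mean width part -/

section WidthPart
variable {n : ℕ}

lemma suppFn_le_iff {K : Set (EuclideanSpace ℝ (Fin n))} (hK : IsCompact K) (hne : K.Nonempty)
    {x : EuclideanSpace ℝ (Fin n)} {t : ℝ} : suppFn K x ≤ t ↔ ∀ y ∈ K, ⟪x, y⟫ ≤ t := by
  have hb : BddAbove ((fun y => ⟪x, y⟫) '' K) :=
    (hK.image (f := fun y => ⟪x, y⟫) (by fun_prop)).bddAbove
  rw [suppFn, csSup_le_iff hb (hne.image _)]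
  simp

lemma le_suppFn {K : Set (EuclideanSpace ℝ (Fin n))} (hK : IsCompact K)
    {x y : EuclideanSpace ℝ (Fin n)} (hy : y ∈ K) : ⟪x, y⟫ ≤ suppFn K x :=
  (suppFn_le_iff hK ⟨y, hy⟩).1 le_rfl y hy

lemma suppFn_smul {K : Set (EuclideanSpace ℝ (Fin n))} (hK : IsCompact K) (hne : K.Nonempty)
    (r : ℝ) (x : EuclideanSpace ℝ (Fin n)) (hr : 0 ≤ r) : suppFn K (r • x) = r * suppFn K x := by
  rcases hr.eq_or_lt with rfl | hr
  · rw [zero_smul, zero_mul]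
    simp [suppFn, hne]
  · refine eq_of_forall_ge_iff fun t => ?_
    rw [suppFn_le_iff hK hne, ← le_div_iff₀' hr, suppFn_le_iff hK hne]
    refine forall₂_congr fun y _ => ?_
    rw [real_inner_smul_left, le_div_iff₀' hr]

lemma suppFn_lip {K : Set (EuclideanSpace ℝ (Fin n))} (hK : IsCompact K) (hne : K.Nonempty)
    (hKB : K ⊆ closedBall 0 1) : LipschitzWith 1 (suppFn K) := by
  refine LipschitzWith.of_le_add fun x y => ?_
  rw [suppFn_le_iff hK hne]
  intro z hz
  have h1 : ⟪x, z⟫ = ⟪y, z⟫ + ⟪x - y, z⟫ := by rw [inner_sub_left]; ring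
  have h2 : ‖z‖ ≤ 1 := by simpa using hKB hz
  have h3 := real_inner_le_norm (x - y) z
  rw [h1, dist_eq_norm]
  have := le_suppFn hK hz (x := y)
  nlinarith [norm_nonneg (x - y)]

lemma suppFn_integrable {K : Set (EuclideanSpace ℝ (Fin n))} (hK : IsCompact K) (hne : K.Nonempty)
    (hKB : K ⊆ closedBall 0 1) : Integrable (suppFn K) (gaussianM n) := by
  have hl := suppFn_lip hK hne hKB
  refine (gaussianM_norm_integrable n).mono' hl.continuous.aestronglyMeasurable
    (Filter.Eventually.of_forall fun x => ?_)
  have h0 : suppFn K 0 = 0 := by simpa using suppFn_smul hK hne 0 0 le_rfl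
  have := hl.dist_le_mul x 0
  rwa [h0, dist_zero_right, dist_zero_right, NNReal.coe_one, one_mul] at this

lemma meanWidth_gauss (hn : 1 ≤ n) : ∃ C : ℝ, 0 < C ∧ ∀ K : Set (EuclideanSpace ℝ (Fin n)),
    IsCompact K → K.Nonempty → K ⊆ closedBall 0 1 →
      meanWidth n K = C * ∫ x, suppFn K x ∂(gaussianM n) := by
  obtain ⟨C, hC, h⟩ := sphere_gauss hn
  have hnp : (0:ℝ) < n := by exact_mod_cast hn
  have hv : 0 < (volume (closedBall (0 : EuclideanSpace ℝ (Fin n)) 1)).toReal :=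
    ENNReal.toReal_pos volB_pos.ne' volB_lt
  refine ⟨1 / (n * (volume (closedBall (0 : EuclideanSpace ℝ (Fin n)) 1)).toReal) * (C * 2),
    by positivity, fun K hK hne hKB => ?_⟩
  have hl := suppFn_lip hK hne hKB
  have hl' : LipschitzWith 1 fun x => suppFn K (-x) :=
    LipschitzWith.of_dist_le_mul fun x y => by
      simpa [dist_neg_neg] using hl.dist_le_mul (-x) (-y)
  have hl2 : LipschitzWith (1 + 1) fun x => suppFn K x + suppFn K (-x) := hl.add hl'
  have hsi := suppFn_integrable hK hne hKB
  have hmap := gaussianM_map n (LinearIsometryEquiv.neg ℝ)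
  have hneg : Integrable (fun x => suppFn K (-x)) (gaussianM n) := by
    rw [← hmap] at hsi
    exact hsi.comp_measurable (LinearIsometryEquiv.neg ℝ).continuous.measurable
  have hnegi : ∫ x, suppFn K (-x) ∂(gaussianM n) = ∫ x, suppFn K x ∂(gaussianM n) := by
    conv_rhs => rw [← hmap, integral_map
      (LinearIsometryEquiv.neg ℝ).continuous.measurable.aemeasurable
      hl.continuous.aestronglyMeasurable]
    rfl
  rw [meanWidth, h _ _ hl2 (fun r x hr => by
    rw [← smul_neg, suppFn_smul hK hne r x hr, suppFn_smul hK hne r _ hr]; ring),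
    integral_add hsi hneg, hnegi]
  ring

lemma suppFn_hull {m : ℕ} (w : Fin (m + 1) → EuclideanSpace ℝ (Fin n)) :
    suppFn (convexHull ℝ (range w)) = mx w := by
  ext x
  refine eq_of_forall_ge_iff fun t => ?_
  rw [suppFn_le_iff ((finite_range w).isCompact_convexHull ℝ)
    (convexHull_nonempty_iff.2 (range_nonempty w)), forall_convexHull_inner_le, mx_le_iff]
  simp [real_inner_comm]

lemma eq_of_suppFn_eq {K K' : Set (EuclideanSpace ℝ (Fin n))} (hK : IsCompact K)
    (hne' : K'.Nonempty) (hK' : IsCompact K') (hc' : Convex ℝ K')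
    (h : suppFn K = suppFn K') : K ⊆ K' := by
  intro x hx
  by_contra hxn
  obtain ⟨v, -, s, hs, hy⟩ := sep_unit hc' hK'.isClosed hne' hxn
  have h1 : suppFn K' v ≤ s := (suppFn_le_iff hK' hne').2 fun y hyK => by
    rw [real_inner_comm]; exact (hy y hyK).le
  have h2 := le_suppFn hK hx (x := v)
  rw [h, real_inner_comm] at h2
  linarith

theorem width_part (hn : 1 ≤ n) {K : Set (EuclideanSpace ℝ (Fin n))}
    (hKcomp : IsCompact K) (hKconv : Convex ℝ K) (hne : K.Nonempty)
    {w : Fin (n + 1) → EuclideanSpace ℝ (Fin n)} (hw : IsRegVerts w)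
    (hL : IsLoewnerEllipsoid (closedBall (0 : EuclideanSpace ℝ (Fin n)) 1) K) :
    meanWidth n (convexHull ℝ (Set.range w)) ≤ meanWidth n K ∧
      (meanWidth n K = meanWidth n (convexHull ℝ (Set.range w)) ↔
        ∃ v : Fin (n + 1) → EuclideanSpace ℝ (Fin n),
          IsRegVerts v ∧ K = convexHull ℝ (Set.range v)) := by
  obtain ⟨ι, _, _, u, c, huK, hd, h0⟩ := loewner_decomp hn hKcomp hL
  have hKB := hL.2.1
  obtain ⟨C, hC, hmw⟩ := meanWidth_gauss hn
  have hreg : ∀ v : Fin (n + 1) → EuclideanSpace ℝ (Fin n), IsRegVerts v →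
      meanWidth n (convexHull ℝ (Set.range v)) = C * ∫ x, mx v x ∂(gaussianM n) := fun v hv => by
    rw [hmw _ ((finite_range v).isCompact_convexHull ℝ)
      (convexHull_nonempty_iff.2 (range_nonempty v))
      (convexHull_min (by rintro _ ⟨i, rfl⟩; simp [hv.1 i]) (convex_closedBall 0 1)), suppFn_hull]
  have hge : ∀ x, mx u x ≤ suppFn K x := fun x => mx_le_iff.2 fun i => by
    rw [real_inner_comm]; exact le_suppFn hKcomp (huK i)
  have hsi := suppFn_integrable hKcomp hne hKB
  have hmi := mx_integrable hd.1
  have hmain := main_compare hn hw hd h0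
  have hle2 : ∫ x, mx u x ∂(gaussianM n) ≤ ∫ x, suppFn K x ∂(gaussianM n) :=
    integral_mono hmi hsi hge
  rw [hreg w hw, hmw K hKcomp hne hKB]
  refine ⟨mul_le_mul_of_nonneg_left (hmain.1.trans hle2) hC.le, fun heq => ?_, ?_⟩
  · have heq' := mul_left_cancel₀ hC.ne' heq
    have h1 : ∫ x, mx u x ∂(gaussianM n) = ∫ x, mx w x ∂(gaussianM n) :=
      le_antisymm (hle2.trans heq'.le) hmain.1
    obtain ⟨v, hv, hvr⟩ := hmain.2 h1
    refine ⟨v, hv, ?_⟩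
    have h2 : suppFn K = mx u := cont_eq_of_integral_eq (suppFn_lip hKcomp hne hKB).continuous
      (mx_cont u) hsi hmi hge (heq'.trans h1.symm)
    have h3 : suppFn K = suppFn (convexHull ℝ (range v)) := by
      rw [h2, suppFn_hull, mx_congr_range hvr]
    refine Subset.antisymm ?_ ?_
    · exact eq_of_suppFn_eq hKcomp (convexHull_nonempty_iff.2 (range_nonempty v))
        ((finite_range v).isCompact_convexHull ℝ) (convex_convexHull ℝ _) h3
    · exact eq_of_suppFn_eq ((finite_range v).isCompact_convexHull ℝ) hne hKcomp hKconv h3.symm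
  · rintro ⟨v, hv, rfl⟩
    rw [suppFn_hull, reg_integral_eq hn hv hw]

end WidthPart

theorem barthe_schmuckenschlaeger_lower_bounds
    (n : ℕ) (hn : 1 ≤ n) (K : Set (EuclideanSpace ℝ (Fin n)))
    (hKcomp : IsCompact K) (hKconv : Convex ℝ K) (hKint : (interior K).Nonempty)
    (w : Fin (n + 1) → EuclideanSpace ℝ (Fin n)) (hw : IsRegVerts w) :
    (IsJohnEllipsoid (closedBall (0 : EuclideanSpace ℝ (Fin n)) 1) K →
      ellNorm n (polarSet (convexHull ℝ (Set.range w))) ≤ ellNorm n K ∧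
      (ellNorm n K = ellNorm n (polarSet (convexHull ℝ (Set.range w))) ↔
        ∃ v : Fin (n + 1) → EuclideanSpace ℝ (Fin n),
          IsRegVerts v ∧ K = polarSet (convexHull ℝ (Set.range v)))) ∧
    (IsLoewnerEllipsoid (closedBall (0 : EuclideanSpace ℝ (Fin n)) 1) K →
      meanWidth n (convexHull ℝ (Set.range w)) ≤ meanWidth n K ∧
      (meanWidth n K = meanWidth n (convexHull ℝ (Set.range w)) ↔
        ∃ v : Fin (n + 1) → EuclideanSpace ℝ (Fin n),
          IsRegVerts v ∧ K = convexHull ℝ (Set.range v))) := by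
  exact ⟨fun hJ => ell_part hn hKcomp hKconv hw hJ,
    fun hL => width_part hn hKcomp hKconv (hKint.mono interior_subset) hw hL⟩

end
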